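/- Golé's ordered ghost-circle theorem (Theorem 4.4): There exists a family {C_ω}_{ω ∈ [ω⁻, ω⁺]} of essential circles in A such that: (i) each C_ω is the graph of a continuous function g_ω : ℝ → [0,1] with g_ω(x+1) = g_ω(x); (ii) the circles are mutually disjoint, and if ω' > ω then g_{ω'}(x) > g_ω(x) for all x (C_{ω'} lies above C_ω); (iii) each C_ω contains an Aubry-Mather set Σ_ω of rotation number ω. -/

import Mathlib

open Set Filter Topology

noncomputable section

/-- The closed annulus `A = ℝ × [0,1]` (universal cover of `𝕋¹ × [0,1]`). -/
def Ann : Set (ℝ × ℝ) := {p | p.2 ∈ Set.Icc (0:ℝ) 1}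

/-- An area-preserving positive monotone twist map of the annulus, given together with
its inverse, as a lift to the universal cover `A = ℝ × [0,1]`. -/
structure AnnulusTwistMap where
  f : ℝ × ℝ → ℝ × ℝ
  finv : ℝ × ℝ → ℝ × ℝ
  smooth : ContDiffOn ℝ 1 f Ann
  smooth_inv : ContDiffOn ℝ 1 finv Ann
  maps : Set.MapsTo f Ann Ann
  maps_inv : Set.MapsTo finv Ann Ann
  left_inv : ∀ p ∈ Ann, finv (f p) = p
  right_inv : ∀ p ∈ Ann, f (finv p) = p
  lift : ∀ p ∈ Ann, f (p.1 + 1, p.2) = f p + (1, 0)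
  orient : ∀ p ∈ Ann, 0 < LinearMap.det ((fderivWithin ℝ f Ann p).toLinearMap)
  bottom : ∀ x : ℝ, (f (x, 0)).2 = 0
  top : ∀ x : ℝ, (f (x, 1)).2 = 1
  area : ∀ s ⊆ Ann, MeasurableSet s → MeasureTheory.volume (f '' s) = MeasureTheory.volume s
  twist : ∀ p ∈ Ann, 0 < derivWithin (fun y => (f (p.1, y)).1) (Set.Icc (0:ℝ) 1) p.2

/-- The graph `{(x, φ(x)) : x ∈ ℝ}` of a function `φ`. -/
def torusGraph (φ : ℝ → ℝ) : Set (ℝ × ℝ) := {p | p.2 = φ p.1}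

/-- `φ` defines an invariant primary torus (essential invariant circle) for `F`. -/
def IsPrimaryTorusFn (F : AnnulusTwistMap) (φ : ℝ → ℝ) : Prop :=
  (∃ K, LipschitzWith K φ) ∧ (∀ x, φ x ∈ Set.Icc (0:ℝ) 1) ∧ (∀ x, φ (x + 1) = φ x) ∧
    F.f '' torusGraph φ = torusGraph φ

/-- `T` is an invariant primary torus for `F`. -/
def IsPrimaryTorus (F : AnnulusTwistMap) (T : Set (ℝ × ℝ)) : Prop :=
  ∃ φ, IsPrimaryTorusFn F φ ∧ T = torusGraph φ

/-- The closed region between the graphs of `φ₁` and `φ₂`. -/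
def zone (φ₁ φ₂ : ℝ → ℝ) : Set (ℝ × ℝ) := {p | φ₁ p.1 ≤ p.2 ∧ p.2 ≤ φ₂ p.1}

/-- The open region strictly between the graphs of `φ₁` and `φ₂` (the interior of the zone). -/
def zoneInterior (φ₁ φ₂ : ℝ → ℝ) : Set (ℝ × ℝ) := {p | φ₁ p.1 < p.2 ∧ p.2 < φ₂ p.1}

/-- The region between the invariant primary tori `graph φ₁` and `graph φ₂` is a
Birkhoff Zone of Instability. -/
def IsBZI (F : AnnulusTwistMap) (φ₁ φ₂ : ℝ → ℝ) : Prop :=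
  IsPrimaryTorusFn F φ₁ ∧ IsPrimaryTorusFn F φ₂ ∧ (∀ x, φ₁ x < φ₂ x) ∧
    ∀ T, IsPrimaryTorus F T → ¬ T ⊆ zoneInterior φ₁ φ₂

/-- `z` has rotation number `ω`. -/
def HasRotNum (F : AnnulusTwistMap) (z : ℝ × ℝ) (ω : ℝ) : Prop :=
  Filter.Tendsto (fun n : ℕ => ((F.f)^[n] z).1 / n) Filter.atTop (nhds ω)

/-- The `n`-th iterate of `F` for `n : ℤ`. -/
def iterZ (F : AnnulusTwistMap) (n : ℤ) (z : ℝ × ℝ) : ℝ × ℝ :=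
  if 0 ≤ n then (F.f)^[n.toNat] z else (F.finv)^[(-n).toNat] z

/-- The extended orbit `EO(z) = {fⁿ(z) + (j,0) : n, j ∈ ℤ}`. -/
def extOrbit (F : AnnulusTwistMap) (z : ℝ × ℝ) : Set (ℝ × ℝ) :=
  {w | ∃ n j : ℤ, w = iterZ F n z + ((j : ℝ), 0)}

/-- A monotone (cyclically ordered) set. -/
def IsMonotoneSet (F : AnnulusTwistMap) (M : Set (ℝ × ℝ)) : Prop :=
  ∀ z₁ ∈ M, ∀ z₂ ∈ M, z₁.1 < z₂.1 → (F.f z₁).1 < (F.f z₂).1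

/-- An Aubry-Mather set of rotation number `ω`: a nonempty, closed, invariant, monotone,
minimal subset of `Rot(ω)`. -/
def IsAubryMather (F : AnnulusTwistMap) (ω : ℝ) (S : Set (ℝ × ℝ)) : Prop :=
  S.Nonempty ∧ IsClosed S ∧ F.f '' S = S ∧ IsMonotoneSet F S ∧
    (∀ z ∈ S, HasRotNum F z ω) ∧
    ∀ S' ⊆ S, S'.Nonempty → IsClosed S' → F.f '' S' = S' → S' = S

theorem isClosed_Ann : IsClosed Ann := isClosed_Icc.preimage continuous_snd

theorem uniqueDiffOn_Ann : UniqueDiffOn ℝ Ann := by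
  have h : Ann = Set.univ ×ˢ Set.Icc (0:ℝ) 1 := by ext p; simp [Ann]
  rw [h]
  exact uniqueDiffOn_univ.prod (uniqueDiffOn_Icc zero_lt_one)

theorem mk_mem_Ann {x y : ℝ} : (x, y) ∈ Ann ↔ y ∈ Set.Icc (0:ℝ) 1 := Iff.rfl

section VerticalMonotonicity

theorem hasDerivWithinAt_vertical {φ : ℝ × ℝ → ℝ} (hφ : ContDiffOn ℝ 1 φ Ann) (x : ℝ) {y : ℝ}
    (hy : y ∈ Set.Icc (0:ℝ) 1) :
    HasDerivWithinAt (fun y => φ (x, y)) (fderivWithin ℝ φ Ann (x, y) (0, 1))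
      (Set.Icc 0 1) y := by
  have h1 : HasFDerivWithinAt φ (fderivWithin ℝ φ Ann (x, y)) Ann (x, y) :=
    ((hφ.differentiableOn one_ne_zero) (x, y) hy).hasFDerivWithinAt
  have h2 : HasDerivWithinAt (fun y : ℝ => (x, y)) ((0:ℝ), (1:ℝ)) (Set.Icc 0 1) y :=
    (hasDerivWithinAt_const _ _ _).prodMk (hasDerivWithinAt_id _ _)
  exact h1.comp_hasDerivWithinAt y h2 (fun t ht => ht)

theorem continuousOn_vertical {φ : ℝ × ℝ → ℝ} (hφ : ContinuousOn φ Ann) (x : ℝ) :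
    ContinuousOn (fun y => φ (x, y)) (Set.Icc (0:ℝ) 1) :=
  hφ.comp (by fun_prop) (fun t ht => ht)

theorem strictMonoOn_vertical {φ : ℝ × ℝ → ℝ} (hφ : ContDiffOn ℝ 1 φ Ann)
    (hpos : ∀ p ∈ Ann, 0 < fderivWithin ℝ φ Ann p (0, 1)) (x : ℝ) :
    StrictMonoOn (fun y => φ (x, y)) (Set.Icc (0:ℝ) 1) := by
  refine strictMonoOn_of_deriv_pos (convex_Icc _ _) (continuousOn_vertical hφ.continuousOn x) ?_
  intro y hy
  rw [interior_Icc] at hy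
  have hy' := Ioo_subset_Icc_self hy
  rw [((hasDerivWithinAt_vertical hφ x hy').hasDerivAt (Icc_mem_nhds hy.1 hy.2)).deriv]
  exact hpos _ hy'

theorem periodic_add_int {φ : ℝ × ℝ → ℝ} {c : ℝ}
    (hper : ∀ x y, y ∈ Set.Icc (0:ℝ) 1 → φ (x + 1, y) = φ (x, y) + c)
    {y : ℝ} (hy : y ∈ Set.Icc (0:ℝ) 1) (j : ℤ) (x : ℝ) : φ (x + j, y) = φ (x, y) + j * c := by
  induction j using Int.induction_on with
  | zero => simp
  | succ i ih =>
    have := hper (x + i) y hy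
    push_cast at ih ⊢
    rw [← add_assoc, this, ih]; ring
  | pred i ih =>
    have := hper (x + (-i - 1)) y hy
    push_cast at ih ⊢
    rw [show x + (-(i:ℝ) - 1) + 1 = x + -i by ring, ih] at this
    linarith

/-- A height function on the annulus that increases along vertical segments satisfies a uniform
cone condition. -/
theorem exists_cone_const_of_vertical_pos {φ : ℝ × ℝ → ℝ} (hφ : ContDiffOn ℝ 1 φ Ann) {c : ℝ}
    (hper : ∀ x y, y ∈ Set.Icc (0:ℝ) 1 → φ (x + 1, y) = φ (x, y) + c)
    (hpos : ∀ p ∈ Ann, 0 < fderivWithin ℝ φ Ann p (0, 1)) :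
    ∃ K : ℝ, ∀ x y a b : ℝ, y ∈ Set.Icc (0:ℝ) 1 → b ∈ Set.Icc (0:ℝ) 1 → φ (a, b) ≤ φ (x, y) →
      b - y ≤ K * |x - a| := by
  set Q : Set (ℝ × ℝ) := Set.Icc (-1:ℝ) 2 ×ˢ Set.Icc (0:ℝ) 1 with hQ
  have hQA : Q ⊆ Ann := fun p hp => hp.2
  have hQc : IsCompact Q := isCompact_Icc.prod isCompact_Icc
  have hQn : Q.Nonempty := ⟨(0, 0), by simp [hQ]⟩
  have hcont : ContinuousOn (fderivWithin ℝ φ Ann) Q :=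
    (hφ.continuousOn_fderivWithin uniqueDiffOn_Ann le_rfl).mono hQA
  obtain ⟨C, hC⟩ := hQc.exists_bound_of_continuousOn hcont
  obtain ⟨q, hq, hmin⟩ := hQc.exists_isMinOn hQn
    (hcont.clm_apply (continuousOn_const (c := ((0:ℝ), (1:ℝ)))))
  set m := fderivWithin ℝ φ Ann q (0, 1) with hm
  have hm0 : 0 < m := hpos q (hQA hq)
  have hC0 : 0 ≤ C := (norm_nonneg _).trans (hC q hq)
  have vert : ∀ x ∈ Set.Icc (-1:ℝ) 2, ∀ y ∈ Set.Icc (0:ℝ) 1, ∀ b ∈ Set.Icc (0:ℝ) 1, y ≤ b →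
      m * (b - y) ≤ φ (x, b) - φ (x, y) := by
    intro x hx
    have hd : ∀ y ∈ Set.Ioo (0:ℝ) 1,
        HasDerivAt (fun y => φ (x, y)) (fderivWithin ℝ φ Ann (x, y) (0, 1)) y := fun y hy =>
      (hasDerivWithinAt_vertical hφ x (Ioo_subset_Icc_self hy)).hasDerivAt
        (Icc_mem_nhds hy.1 hy.2)
    refine (convex_Icc (0:ℝ) 1).mul_sub_le_image_sub_of_le_deriv
      (continuousOn_vertical hφ.continuousOn x) ?_ ?_
    · rw [interior_Icc]
      exact fun y hy => (hd y hy).differentiableAt.differentiableWithinAt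
    · rw [interior_Icc]
      intro y hy
      rw [(hd y hy).deriv]
      exact hmin (show (x, y) ∈ Q from ⟨hx, Ioo_subset_Icc_self hy⟩)
  have horiz : ∀ x ∈ Set.Icc (-1:ℝ) 2, ∀ a ∈ Set.Icc (-1:ℝ) 2, ∀ y ∈ Set.Icc (0:ℝ) 1,
      φ (x, y) - φ (a, y) ≤ C * |x - a| := by
    intro x hx a ha y hy
    have := ((convex_Icc (-1:ℝ) 2).prod (convex_Icc (0:ℝ) 1)).norm_image_sub_le_of_norm_hasFDerivWithin_le
      (f := φ) (f' := fderivWithin ℝ φ Ann) (C := C)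
      (fun p hp => ((hφ.differentiableOn one_ne_zero) p (hQA hp)).hasFDerivWithinAt.mono hQA)
      hC (x := (a, y)) (y := (x, y)) ⟨ha, hy⟩ ⟨hx, hy⟩
    have h2 : ‖(x, y) - (a, y)‖ = |x - a| := by simp [Prod.norm_def]
    rw [h2] at this
    exact (le_abs_self _).trans this
  refine ⟨max 1 (C / m), ?_⟩
  intro x y a b hy hb hle
  by_cases hfar : 1 ≤ |x - a|
  · have h1 : b - y ≤ 1 := by linarith [hy.1, hb.2]
    have h2 : (1:ℝ) ≤ max 1 (C / m) := le_max_left _ _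
    nlinarith [abs_nonneg (x - a)]
  by_cases hby : b ≤ y
  · have : 0 ≤ max 1 (C / m) * |x - a| := by positivity
    linarith
  push Not at hfar hby
  set j := ⌊x⌋
  have hx0 : x + ((-j : ℤ) : ℝ) ∈ Set.Icc (0:ℝ) 1 := by
    push_cast
    exact ⟨by linarith [Int.floor_le x], by linarith [Int.lt_floor_add_one x]⟩
  have e1 := periodic_add_int hper hy (-j) x
  have e2 := periodic_add_int hper hb (-j) a
  rw [abs_lt] at hfar
  have ha0 : a + ((-j : ℤ) : ℝ) ∈ Set.Icc (-1:ℝ) 2 :=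
    ⟨by linarith [hx0.1, hx0.2], by linarith [hx0.1, hx0.2]⟩
  have hx1 : x + ((-j : ℤ) : ℝ) ∈ Set.Icc (-1:ℝ) 2 :=
    ⟨by linarith [hx0.1, hx0.2], by linarith [hx0.1, hx0.2]⟩
  have v := vert _ ha0 y hy b hb hby.le
  have w := horiz _ hx1 _ ha0 y hy
  rw [add_sub_add_right_eq_sub] at w
  have h3 : m * (b - y) ≤ C * |x - a| := by linarith
  have h4 : b - y ≤ C / m * |x - a| := by
    rw [div_mul_eq_mul_div, le_div_iff₀ hm0]; linarith
  exact h4.trans (mul_le_mul_of_nonneg_right (le_max_right _ _) (abs_nonneg _))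

end VerticalMonotonicity

namespace AnnulusTwistMap

section Basics

variable (F : AnnulusTwistMap)

theorem contDiffOn_fst : ContDiffOn ℝ 1 (fun p => (F.f p).1) Ann := F.smooth.fst

theorem contDiffOn_inv_fst : ContDiffOn ℝ 1 (fun p => (F.finv p).1) Ann := F.smooth_inv.fst

theorem lift_inv {p : ℝ × ℝ} (hp : p ∈ Ann) : F.finv (p.1 + 1, p.2) = F.finv p + (1, 0) := by
  have h1 := F.lift (F.finv p) (F.maps_inv hp)
  rw [F.right_inv p hp] at h1
  have h2 : p + (1, 0) = (p.1 + 1, p.2) := by ext <;> simp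
  rw [← h2, ← h1, F.left_inv ((F.finv p).1 + 1, (F.finv p).2) (F.maps_inv hp)]
  ext <;> simp

theorem fst_lift (x y : ℝ) (hy : y ∈ Set.Icc (0:ℝ) 1) :
    (F.f (x + 1, y)).1 = (F.f (x, y)).1 + 1 := by
  rw [F.lift (x, y) hy]; simp

theorem inv_fst_lift (x y : ℝ) (hy : y ∈ Set.Icc (0:ℝ) 1) :
    (F.finv (x + 1, y)).1 = (F.finv (x, y)).1 + 1 := by
  rw [F.lift_inv (p := (x, y)) hy]; simp

theorem fst_add_int (x : ℝ) {y : ℝ} (hy : y ∈ Set.Icc (0:ℝ) 1) (j : ℤ) :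
    (F.f (x + j, y)).1 = (F.f (x, y)).1 + j := by
  simpa using periodic_add_int (φ := fun p => (F.f p).1) (F.fst_lift) hy j x

theorem map_add_int (p : ℝ × ℝ) (hp : p ∈ Ann) (j : ℤ) :
    F.f (p + ((j:ℝ), 0)) = F.f p + ((j:ℝ), 0) := by
  have h1 := F.fst_add_int p.1 (y := p.2) hp j
  have h2 : (F.f (p.1 + j, p.2)).2 = (F.f p).2 := by
    simpa using periodic_add_int (φ := fun p => (F.f p).2) (c := 0)
      (fun x y hy => by rw [F.lift (x, y) hy]; simp) hp j p.1
  have h3 : p + ((j:ℝ), 0) = (p.1 + j, p.2) := by ext <;> simp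
  rw [h3]
  ext
  · simpa using h1
  · simpa using h2

theorem fderivWithin_fst_pos (p : ℝ × ℝ) (hp : p ∈ Ann) :
    0 < fderivWithin ℝ (fun p => (F.f p).1) Ann p (0, 1) := by
  have h := F.twist p hp
  rwa [(hasDerivWithinAt_vertical F.contDiffOn_fst p.1 (y := p.2) hp).derivWithin
    ((uniqueDiffOn_Icc zero_lt_one) _ hp)] at h

theorem fderivWithin_inv_fst_neg (p : ℝ × ℝ) (hp : p ∈ Ann) :
    0 < fderivWithin ℝ (fun p => -(F.finv p).1) Ann p (0, 1) := by
  have hq : F.finv p ∈ Ann := F.maps_inv hp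
  have hG : HasFDerivWithinAt F.finv (fderivWithin ℝ F.finv Ann p) Ann p :=
    ((F.smooth_inv.differentiableOn one_ne_zero) p hp).hasFDerivWithinAt
  have hF : HasFDerivWithinAt F.f (fderivWithin ℝ F.f Ann (F.finv p)) Ann (F.finv p) :=
    ((F.smooth.differentiableOn one_ne_zero) _ hq).hasFDerivWithinAt
  have hF1 := (hasFDerivAt_fst (𝕜 := ℝ) (p := F.f (F.finv p))).comp_hasFDerivWithinAt _ hF
  have hG1 := ((hasFDerivAt_fst (𝕜 := ℝ) (p := F.finv p)).comp_hasFDerivWithinAt _ hG).neg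
  have hu := uniqueDiffOn_Ann p hp
  have e1 : fderivWithin ℝ (fun p => -(F.finv p).1) Ann p (0, 1) =
      -(fderivWithin ℝ F.finv Ann p (0, 1)).1 := by
    have := hG1.fderivWithin hu
    have e : (-(Prod.fst ∘ F.finv) : ℝ × ℝ → ℝ) = (fun p => -(F.finv p).1) := rfl
    rw [e] at this
    rw [this]; rfl
  have e2 : fderivWithin ℝ (fun p => (F.f p).1) Ann (F.finv p) (0, 1) =
      (fderivWithin ℝ F.f Ann (F.finv p) (0, 1)).1 := by
    have := hF1.fderivWithin (uniqueDiffOn_Ann _ hq)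
    have e : ((Prod.fst ∘ F.f) : ℝ × ℝ → ℝ) = (fun p => (F.f p).1) := rfl
    rw [e] at this
    rw [this]; rfl
  have hb := F.fderivWithin_fst_pos _ hq
  rw [e2] at hb
  rw [e1]
  have hcomp : HasFDerivWithinAt (fun p => p)
      ((fderivWithin ℝ F.f Ann (F.finv p)).comp (fderivWithin ℝ F.finv Ann p)) Ann p :=
    (hF.comp p hG F.maps_inv).congr (fun q hq => (F.right_inv q hq).symm) (F.right_inv p hp).symm
  have hid := hu.eq hcomp (hasFDerivWithinAt_id p Ann)
  have hdet := F.orient _ hq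
  set A := fderivWithin ℝ F.f Ann (F.finv p)
  set B := fderivWithin ℝ F.finv Ann p
  have h01 : A (B (0, 1)) = (0, 1) := by
    have := congrArg (fun T : (ℝ × ℝ) →L[ℝ] (ℝ × ℝ) => T (0, 1)) hid
    simpa using this
  have hAlin : ∀ u v : ℝ, A (u, v) = u • A (1, 0) + v • A (0, 1) := by
    intro u v
    rw [← map_smul, ← map_smul, ← map_add]; simp
  have hd : LinearMap.det A.toLinearMap =
      (A (1, 0)).1 * (A (0, 1)).2 - (A (0, 1)).1 * (A (1, 0)).2 := by
    rw [← LinearMap.det_toMatrix (Module.Basis.finTwoProd ℝ), Matrix.det_fin_two]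
    simp [LinearMap.toMatrix_apply]
  rw [hd] at hdet
  have h := hAlin (B (0, 1)).1 (B (0, 1)).2
  rw [Prod.mk.eta, h01] at h
  have r1 := congrArg Prod.fst h
  have r2 := congrArg Prod.snd h
  simp at r1 r2
  set β := (B (0, 1)).1
  set δ := (B (0, 1)).2
  have key : ((A (1, 0)).1 * (A (0, 1)).2 - (A (0, 1)).1 * (A (1, 0)).2) * β = -(A (0, 1)).1 := by
    linear_combination (-(A (0,1)).2) * r1 + (A (0,1)).1 * r2
  nlinarith

theorem strictMonoOn_fst (x : ℝ) : StrictMonoOn (fun y => (F.f (x, y)).1) (Set.Icc (0:ℝ) 1) :=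
  strictMonoOn_vertical F.contDiffOn_fst F.fderivWithin_fst_pos x

theorem strictAntiOn_inv_fst (x : ℝ) :
    StrictAntiOn (fun y => (F.finv (x, y)).1) (Set.Icc (0:ℝ) 1) := by
  have := (strictMonoOn_vertical F.contDiffOn_inv_fst.neg F.fderivWithin_inv_fst_neg x).neg
  simpa using this

theorem continuousOn_f_fst : ContinuousOn (fun p => (F.f p).1) Ann := F.contDiffOn_fst.continuousOn

theorem continuousOn_inv_fst : ContinuousOn (fun p => (F.finv p).1) Ann :=
  F.contDiffOn_inv_fst.continuousOn

/-- Uniform cone condition for pairs of points that are not crossing in the wrong direction. -/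
theorem exists_cone_const : ∃ K : ℝ, 0 ≤ K ∧ ∀ p ∈ Ann, ∀ q ∈ Ann,
    ((F.finv q).1 ≤ (F.finv p).1 → (F.f q).1 ≤ (F.f p).1) → q.2 - p.2 ≤ K * |p.1 - q.1| := by
  obtain ⟨K₁, h₁⟩ := exists_cone_const_of_vertical_pos F.contDiffOn_fst (F.fst_lift)
    F.fderivWithin_fst_pos
  obtain ⟨K₂, h₂⟩ := exists_cone_const_of_vertical_pos F.contDiffOn_inv_fst.neg (c := -1)
    (fun x y hy => by rw [F.inv_fst_lift x y hy]; ring) F.fderivWithin_inv_fst_neg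
  refine ⟨max 0 (max K₁ K₂), le_max_left _ _, ?_⟩
  rintro ⟨x, y⟩ hp ⟨a, b⟩ hq h
  rcases le_or_gt (F.finv (a, b)).1 (F.finv (x, y)).1 with h' | h'
  · refine (h₁ x y a b hp hq (h h')).trans (mul_le_mul_of_nonneg_right ?_ (abs_nonneg _))
    exact (le_max_left _ _).trans (le_max_right _ _)
  · refine (h₂ x y a b hp hq (by linarith)).trans
      (mul_le_mul_of_nonneg_right ?_ (abs_nonneg _))
    exact (le_max_right _ _).trans (le_max_right _ _)

theorem strictMono_boundary {e : ℝ} (he : e ∈ Set.Icc (0:ℝ) 1)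
    (hinv : ∀ x : ℝ, (F.f (x, e)).2 = e) : StrictMono (fun x => (F.f (x, e)).1) := by
  have hc : Continuous (fun x : ℝ => (F.f (x, e)).1) :=
    F.continuousOn_f_fst.comp_continuous (by fun_prop) (fun x => he)
  have hi : Function.Injective (fun x : ℝ => (F.f (x, e)).1) := by
    intro x x' h
    have : F.f (x, e) = F.f (x', e) := Prod.ext h (by rw [hinv, hinv])
    have := congrArg F.finv this
    rw [F.left_inv _ he, F.left_inv _ he] at this
    exact congrArg Prod.fst this
  rcases hc.strictMono_of_inj hi with h | h
  · exact h
  · have h1 := h (show (0:ℝ) < 0 + 1 by norm_num)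
    have h2 := F.fst_lift 0 e he
    simp only at h1
    linarith

theorem continuousOn_iterate (n : ℕ) : ContinuousOn ((F.f)^[n]) Ann :=
  F.smooth.continuousOn.iterate F.maps n

theorem iterate_boundary {e : ℝ} (hinv : ∀ x : ℝ, (F.f (x, e)).2 = e) (x : ℝ) (n : ℕ) :
    ((F.f)^[n] (x, e)) = ((fun x => (F.f (x, e)).1)^[n] x, e) := by
  induction n with
  | zero => rfl
  | succ n ih =>
    rw [Function.iterate_succ_apply', ih, Function.iterate_succ_apply']
    exact Prod.ext rfl (hinv _)

/-- If the lower boundary has positive rotation number, every point moves to the right by a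
definite amount. -/
theorem exists_displacement {ωm : ℝ} (hbot : ∀ x : ℝ, HasRotNum F (x, 0) ωm) (h0 : 0 < ωm) :
    ∃ δ > 0, ∃ c, ∀ p ∈ Ann, p.1 + δ ≤ (F.f p).1 ∧ (F.f p).1 ≤ p.1 + c := by
  have h0m : (0:ℝ) ∈ Set.Icc (0:ℝ) 1 := by simp
  have hpos : ∀ x y, y ∈ Set.Icc (0:ℝ) 1 → x < (F.f (x, y)).1 := by
    intro x y hy
    have h1 : x < (F.f (x, 0)).1 := by
      by_contra hcon
      push Not at hcon
      have hmono := (F.strictMono_boundary h0m F.bottom).monotone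
      have hit : ∀ n : ℕ, ((F.f)^[n] (x, 0)).1 ≤ x := by
        intro n
        rw [F.iterate_boundary F.bottom]
        induction n with
        | zero => simp
        | succ n ih =>
          rw [Function.iterate_succ_apply']
          exact (hmono ih).trans hcon
      have hlim := hbot x
      have hz : Tendsto (fun n : ℕ => x / (n:ℝ)) atTop (𝓝 0) :=
        tendsto_const_div_atTop_nhds_zero_nat x
      have := le_of_tendsto_of_tendsto' hlim hz
        (fun n => div_le_div_of_nonneg_right (hit n) (Nat.cast_nonneg n))
      linarith
    exact h1.trans_le ((F.strictMonoOn_fst x).monotoneOn h0m hy hy.1)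
  have hQc : IsCompact (Set.Icc (0:ℝ) 1 ×ˢ Set.Icc (0:ℝ) 1) := isCompact_Icc.prod isCompact_Icc
  have hQn : (Set.Icc (0:ℝ) 1 ×ˢ Set.Icc (0:ℝ) 1).Nonempty := ⟨(0, 0), by simp⟩
  have hcont : ContinuousOn (fun p => (F.f p).1 - p.1) (Set.Icc (0:ℝ) 1 ×ˢ Set.Icc (0:ℝ) 1) :=
    (F.continuousOn_f_fst.mono (fun p hp => hp.2)).sub continuousOn_fst
  obtain ⟨q, hq, hmin⟩ := hQc.exists_isMinOn hQn hcont
  obtain ⟨r, hr, hmax⟩ := hQc.exists_isMaxOn hQn hcont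
  refine ⟨(F.f q).1 - q.1, sub_pos.2 (hpos q.1 q.2 hq.2), (F.f r).1 - r.1, ?_⟩
  rintro ⟨x, y⟩ hp
  have e := F.fst_add_int x (y := y) hp (-⌊x⌋)
  have hm : (x + ((-⌊x⌋ : ℤ) : ℝ), y) ∈ Set.Icc (0:ℝ) 1 ×ˢ Set.Icc (0:ℝ) 1 := by
    refine ⟨?_, hp⟩
    push_cast
    exact ⟨by linarith [Int.floor_le x], by linarith [Int.lt_floor_add_one x]⟩
  have h1 := isMinOn_iff.1 hmin _ hm
  have h2 := isMaxOn_iff.1 hmax _ hm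
  rw [e] at h1 h2
  constructor <;> simp only <;> linarith

end Basics

end AnnulusTwistMap

theorem volume_real_le_of_subset_rectangle {S : Set (ℝ × ℝ)} {a b c d : ℝ} (hab : a ≤ b)
    (hcd : c ≤ d) (h : S ⊆ Set.Icc a b ×ˢ Set.Icc c d) :
    MeasureTheory.volume.real S ≤ (b - a) * (d - c) := by
  have h1 : MeasureTheory.volume.real (Set.Icc a b ×ˢ Set.Icc c d) = (b - a) * (d - c) := by
    rw [MeasureTheory.Measure.volume_eq_prod, MeasureTheory.measureReal_prod_prod,
      Real.volume_real_Icc_of_le hab, Real.volume_real_Icc_of_le hcd]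
  rw [← h1]
  exact MeasureTheory.measureReal_mono h (isCompact_Icc.prod isCompact_Icc).measure_ne_top

theorem le_volume_real_of_rectangle_subset {S : Set (ℝ × ℝ)} {a b c d : ℝ} (hab : a ≤ b)
    (hcd : c ≤ d) (h : Set.Ioo a b ×ˢ Set.Ioo c d ⊆ S) (hS : MeasureTheory.volume S ≠ ⊤) :
    (b - a) * (d - c) ≤ MeasureTheory.volume.real S := by
  have h1 : MeasureTheory.volume.real (Set.Ioo a b ×ˢ Set.Ioo c d) = (b - a) * (d - c) := by
    rw [MeasureTheory.Measure.volume_eq_prod, MeasureTheory.measureReal_prod_prod,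
      Real.volume_real_Ioo_of_le hab, Real.volume_real_Ioo_of_le hcd]
  rw [← h1]
  exact MeasureTheory.measureReal_mono h hS

namespace AnnulusTwistMap

section Action

variable (F : AnnulusTwistMap)

/-- The points of the annulus to the right of `x` whose image is to the left of `x'`. -/
def passage (x x' : ℝ) : Set (ℝ × ℝ) := {z | z ∈ Ann ∧ x ≤ z.1 ∧ (F.f z).1 ≤ x'}

/-- The generating function of the twist map, as an area. -/
def action (x x' : ℝ) : ℝ := MeasureTheory.volume.real (F.passage x x')

theorem measurableSet_passage (x x' : ℝ) : MeasurableSet (F.passage x x') := by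
  have h1 := F.continuousOn_f_fst.preimage_isClosed_of_isClosed isClosed_Ann
    (isClosed_Iic (a := x'))
  have h2 : IsClosed {z : ℝ × ℝ | x ≤ z.1} := isClosed_le continuous_const continuous_fst
  have h3 : F.passage x x' = (Ann ∩ (fun p => (F.f p).1) ⁻¹' Set.Iic x') ∩ {z | x ≤ z.1} := by
    ext z; simp only [passage, mem_ofPred_eq, mem_inter_iff, mem_preimage, mem_Iic]; tauto
  rw [h3]
  exact (h1.inter h2).measurableSet

theorem image_passage_diff (x a x' a' : ℝ) : F.f '' (F.passage x a' \ F.passage a x') =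
    {w | w ∈ Ann ∧ x ≤ (F.finv w).1 ∧ w.1 ≤ a' ∧ (a ≤ (F.finv w).1 → x' < w.1)} := by
  ext w
  constructor
  · rintro ⟨z, ⟨⟨hz, h1, h2⟩, h3⟩, rfl⟩
    refine ⟨F.maps hz, by rwa [F.left_inv z hz], h2, ?_⟩
    rw [F.left_inv z hz]
    intro h4
    by_contra h5
    exact h3 ⟨hz, h4, not_lt.1 h5⟩
  · rintro ⟨hw, h1, h2, h3⟩
    refine ⟨F.finv w, ⟨⟨F.maps_inv hw, h1, by rwa [F.right_inv w hw]⟩, ?_⟩, F.right_inv w hw⟩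
    rintro ⟨-, h4, h5⟩
    rw [F.right_inv w hw] at h5
    exact absurd (h3 h4) (not_lt.2 h5)

theorem action_add_one (x x' : ℝ) : F.action (x + 1) (x' + 1) = F.action x x' := by
  have h1 : F.passage x x' = (fun z => z + ((1:ℝ), (0:ℝ))) ⁻¹' F.passage (x + 1) (x' + 1) := by
    ext z
    have e : z ∈ Ann → F.f (z + (1, 0)) = F.f z + (1, 0) := fun hz => by
      have := F.map_add_int z hz 1
      simpa using this
    simp only [passage, mem_ofPred_eq, mem_preimage]
    have e2 : z + ((1:ℝ), (0:ℝ)) ∈ Ann ↔ z ∈ Ann := by simp [Ann]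
    rw [e2]
    refine and_congr_right fun hz => ?_
    rw [e hz]
    simp
  rw [action, action, h1, MeasureTheory.measureReal_def, MeasureTheory.measureReal_def,
    MeasureTheory.measure_preimage_add_right]

theorem action_add_int (x x' : ℝ) (j : ℤ) : F.action (x + j) (x' + j) = F.action x x' := by
  induction j using Int.induction_on with
  | zero => simp
  | succ i ih =>
    push_cast at ih ⊢
    rw [← add_assoc, ← add_assoc, F.action_add_one, ih]
  | pred i ih =>
    push_cast at ih ⊢
    rw [← ih, ← F.action_add_one (x + (-i - 1))]
    congr 1 <;> ring

theorem action_nonneg (x x' : ℝ) : 0 ≤ F.action x x' := MeasureTheory.measureReal_nonneg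

variable {F} {c : ℝ} (hd : ∀ p ∈ Ann, p.1 ≤ (F.f p).1 ∧ (F.f p).1 ≤ p.1 + c)

include hd

theorem passage_subset (x x' : ℝ) : F.passage x x' ⊆ Set.Icc x x' ×ˢ Set.Icc 0 1 :=
  fun z hz => ⟨⟨hz.2.1, (hd z hz.1).1.trans hz.2.2⟩, hz.1⟩

theorem volume_passage_ne_top (x x' : ℝ) : MeasureTheory.volume (F.passage x x') ≠ ⊤ :=
  MeasureTheory.measure_ne_top_of_subset (passage_subset hd x x')
    (isCompact_Icc.prod isCompact_Icc).measure_ne_top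

theorem action_sub_left {x a : ℝ} (h : x ≤ a) (x' : ℝ) : F.action x x' - F.action a x' =
    MeasureTheory.volume.real {z | z ∈ Ann ∧ x ≤ z.1 ∧ z.1 < a ∧ (F.f z).1 ≤ x'} := by
  have hs : F.passage a x' ⊆ F.passage x x' := fun z hz => ⟨hz.1, h.trans hz.2.1, hz.2.2⟩
  rw [action, action, ← MeasureTheory.measureReal_sdiff hs (F.measurableSet_passage a x')
    (volume_passage_ne_top hd x x')]
  congr 1
  ext z
  simp only [passage, Set.mem_sdiff, mem_ofPred_eq]
  constructor
  · rintro ⟨⟨h1, h2, h3⟩, h4⟩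
    exact ⟨h1, h2, by by_contra h5; exact h4 ⟨h1, not_lt.1 h5, h3⟩, h3⟩
  · rintro ⟨h1, h2, h3, h4⟩
    exact ⟨⟨h1, h2, h4⟩, fun h5 => absurd h5.2.1 (not_le.2 h3)⟩

theorem action_sub_right (x : ℝ) {x' a' : ℝ} (h : x' ≤ a') : F.action x a' - F.action x x' =
    MeasureTheory.volume.real {w | w ∈ Ann ∧ x ≤ (F.finv w).1 ∧ x' < w.1 ∧ w.1 ≤ a'} := by
  have hs : F.passage x x' ⊆ F.passage x a' := fun z hz => ⟨hz.1, hz.2.1, hz.2.2.trans h⟩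
  rw [action, action, ← MeasureTheory.measureReal_sdiff hs (F.measurableSet_passage x x')
    (volume_passage_ne_top hd x a')]
  have h2 := F.area (F.passage x a' \ F.passage x x') (fun z hz => hz.1.1)
    ((F.measurableSet_passage x a').diff (F.measurableSet_passage x x'))
  rw [image_passage_diff] at h2
  rw [MeasureTheory.measureReal_def, MeasureTheory.measureReal_def, ← h2]
  congr 2
  ext w
  simp only [mem_ofPred_eq]
  tauto

theorem action_submodular {x a x' a' : ℝ} (h : x ≤ a) (h' : x' ≤ a') :
    F.action x x' + F.action a a' ≤ F.action x a' + F.action a x' := by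
  have h1 := action_sub_left hd h a'
  have h2 := action_sub_left hd h x'
  have h3 := MeasureTheory.measureReal_mono (μ := MeasureTheory.volume)
    (s₁ := {z | z ∈ Ann ∧ x ≤ z.1 ∧ z.1 < a ∧ (F.f z).1 ≤ x'})
    (s₂ := {z | z ∈ Ann ∧ x ≤ z.1 ∧ z.1 < a ∧ (F.f z).1 ≤ a'})
    (fun z hz => ⟨hz.1, hz.2.1, hz.2.2.1, hz.2.2.2.trans h'⟩)
    (MeasureTheory.measure_ne_top_of_subset (s := F.passage x a')
      (fun z hz => ⟨hz.1, hz.2.1, hz.2.2.2⟩) (volume_passage_ne_top hd x a'))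
  linarith

theorem action_max_add_min (x a x' a' : ℝ) :
    F.action (max x a) (max x' a') + F.action (min x a) (min x' a') ≤
      F.action x x' + F.action a a' := by
  rcases le_total x a with h | h <;> rcases le_total x' a' with h' | h' <;>
    simp only [h, h', max_eq_left, max_eq_right, min_eq_left, min_eq_right]
  · linarith
  · linarith [action_submodular hd h h']
  · linarith [action_submodular hd h h']
  · linarith

theorem le_action (x x' : ℝ) : x' - x - c ≤ F.action x x' := by
  rcases le_or_gt (x' - c) x with h | h
  · linarith [F.action_nonneg x x']
  have := le_volume_real_of_rectangle_subset h.le zero_le_one (S := F.passage x x')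
    (fun z hz => ⟨Ioo_subset_Icc_self hz.2, hz.1.1.le,
      ((hd z (Ioo_subset_Icc_self hz.2)).2).trans (by linarith [hz.1.2])⟩)
    (volume_passage_ne_top hd x x')
  rw [action]; linarith

/-- Upper bound for the horizontal variation of the action in the first variable. -/
theorem action_sub_left_le {x a x' η : ℝ} (h : x ≤ a) (hη : η ∈ Set.Icc (0:ℝ) 1)
    (hs : ∀ s ∈ Set.Icc x a, η = 1 ∨ x' < (F.f (s, η)).1) :
    F.action x x' - F.action a x' ≤ (a - x) * η := by
  rw [action_sub_left hd h]
  have := volume_real_le_of_subset_rectangle h hη.1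
    (S := {z | z ∈ Ann ∧ x ≤ z.1 ∧ z.1 < a ∧ (F.f z).1 ≤ x'}) ?_
  · simpa using this
  · rintro ⟨s, y⟩ ⟨hz, h1, h2, h3⟩
    refine ⟨⟨h1, h2.le⟩, hz.1, ?_⟩
    rcases hs s ⟨h1, h2.le⟩ with h4 | h4
    · rw [h4]; exact hz.2
    · exact (((F.strictMonoOn_fst s).lt_iff_lt hz hη).1 (h3.trans_lt h4)).le

theorem le_action_sub_left {x a x' η : ℝ} (h : x ≤ a) (hη : η ∈ Set.Icc (0:ℝ) 1)
    (hs : ∀ s ∈ Set.Icc x a, (F.f (s, η)).1 ≤ x') :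
    (a - x) * η ≤ F.action x x' - F.action a x' := by
  rw [action_sub_left hd h]
  have := le_volume_real_of_rectangle_subset h hη.1
    (S := {z | z ∈ Ann ∧ x ≤ z.1 ∧ z.1 < a ∧ (F.f z).1 ≤ x'}) ?_
    (MeasureTheory.measure_ne_top_of_subset (s := F.passage x x')
      (fun z hz => ⟨hz.1, hz.2.1, hz.2.2.2⟩) (volume_passage_ne_top hd x x'))
  · simpa using this
  · rintro ⟨s, y⟩ ⟨h1, h2⟩
    have hy : y ∈ Set.Icc (0:ℝ) 1 := ⟨h2.1.le, h2.2.le.trans hη.2⟩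
    exact ⟨hy, h1.1.le, h1.2, ((F.strictMonoOn_fst s).monotoneOn hy hη h2.2.le).trans
      (hs s ⟨h1.1.le, h1.2.le⟩)⟩

theorem action_sub_right_le {x x' a' η : ℝ} (h : x' ≤ a') (hη : η ∈ Set.Icc (0:ℝ) 1)
    (hs : ∀ s ∈ Set.Icc x' a', η = 1 ∨ (F.finv (s, η)).1 < x) :
    F.action x a' - F.action x x' ≤ (a' - x') * η := by
  rw [action_sub_right hd x h]
  have := volume_real_le_of_subset_rectangle h hη.1
    (S := {w | w ∈ Ann ∧ x ≤ (F.finv w).1 ∧ x' < w.1 ∧ w.1 ≤ a'}) ?_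
  · simpa using this
  · rintro ⟨s, y⟩ ⟨hz, h1, h2, h3⟩
    refine ⟨⟨h2.le, h3⟩, hz.1, ?_⟩
    rcases hs s ⟨h2.le, h3⟩ with h4 | h4
    · rw [h4]; exact hz.2
    · exact (((F.strictAntiOn_inv_fst s).lt_iff_gt hη hz).1 (h4.trans_le h1)).le

theorem le_action_sub_right {x x' a' η : ℝ} (h : x' ≤ a') (hη : η ∈ Set.Icc (0:ℝ) 1)
    (hs : ∀ s ∈ Set.Icc x' a', x ≤ (F.finv (s, η)).1) :
    (a' - x') * η ≤ F.action x a' - F.action x x' := by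
  rw [action_sub_right hd x h]
  have := le_volume_real_of_rectangle_subset h hη.1
    (S := {w | w ∈ Ann ∧ x ≤ (F.finv w).1 ∧ x' < w.1 ∧ w.1 ≤ a'}) ?_ ?_
  · simpa using this
  · rintro ⟨s, y⟩ ⟨h1, h2⟩
    have hy : y ∈ Set.Icc (0:ℝ) 1 := ⟨h2.1.le, h2.2.le.trans hη.2⟩
    exact ⟨hy, (hs s ⟨h1.1.le, h1.2.le⟩).trans
      ((F.strictAntiOn_inv_fst s).antitoneOn hy hη h2.2.le), h1.1, h1.2.le⟩
  · exact MeasureTheory.measure_ne_top_of_subset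
      (fun z hz => (⟨⟨hz.2.2.1.le, hz.2.2.2⟩, hz.1⟩ : z ∈ Set.Icc x' a' ×ˢ Set.Icc (0:ℝ) 1))
      (isCompact_Icc.prod isCompact_Icc).measure_ne_top

theorem abs_action_sub_le (x a x' a' : ℝ) :
    |F.action x x' - F.action a a'| ≤ |x - a| + |x' - a'| := by
  have key1 : ∀ x a x' : ℝ, |F.action x x' - F.action a x'| ≤ |x - a| := by
    intro x a x'
    have hle : ∀ x a : ℝ, x ≤ a → |F.action x x' - F.action a x'| ≤ |x - a| := by
      intro x a h
      have h1 := action_sub_left_le hd (x' := x') h (η := 1) (by simp) (fun s _ => Or.inl rfl)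
      have h2 : 0 ≤ F.action x x' - F.action a x' := by
        rw [action_sub_left hd h]; exact MeasureTheory.measureReal_nonneg
      rw [abs_of_nonneg h2, abs_sub_comm, abs_of_nonneg (by linarith)]; linarith
    rcases le_total x a with h | h
    · exact hle x a h
    · rw [abs_sub_comm, abs_sub_comm x]; exact hle a x h
  have key2 : ∀ x x' a' : ℝ, |F.action x x' - F.action x a'| ≤ |x' - a'| := by
    intro x x' a'
    have hle : ∀ x' a' : ℝ, x' ≤ a' → |F.action x a' - F.action x x'| ≤ |a' - x'| := by
      intro x' a' h
      have h1 := action_sub_right_le hd (x := x) h (η := 1) (by simp) (fun s _ => Or.inl rfl)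
      have h2 : 0 ≤ F.action x a' - F.action x x' := by
        rw [action_sub_right hd x h]; exact MeasureTheory.measureReal_nonneg
      rw [abs_of_nonneg h2, abs_of_nonneg (by linarith)]; linarith
    rcases le_total x' a' with h | h
    · rw [abs_sub_comm, abs_sub_comm x']; exact hle x' a' h
    · exact hle a' x' h
  calc |F.action x x' - F.action a a'|
      = |(F.action x x' - F.action a x') + (F.action a x' - F.action a a')| := by ring_nf
    _ ≤ _ := (abs_add_le _ _).trans (add_le_add (key1 _ _ _) (key2 _ _ _))

theorem continuous_action : Continuous (fun q : ℝ × ℝ => F.action q.1 q.2) := by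
  refine LipschitzWith.continuous (K := 2) (LipschitzWith.of_dist_le_mul fun p q => ?_)
  rw [Real.dist_eq]
  refine (abs_action_sub_le hd _ _ _ _).trans ?_
  have h1 : |p.1 - q.1| ≤ dist p q := by rw [← Real.dist_eq, Prod.dist_eq]; exact le_max_left _ _
  have h2 : |p.2 - q.2| ≤ dist p q := by rw [← Real.dist_eq, Prod.dist_eq]; exact le_max_right _ _
  push_cast
  linarith

end Action

end AnnulusTwistMap

/-- A bi-infinite configuration of type `(p, N)`. -/
def IsConfig (N : ℕ) (p : ℤ) (x : ℤ → ℝ) : Prop := ∀ i, x (i + N) = x i + p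

theorem IsConfig.shift {N : ℕ} {p : ℤ} {x : ℤ → ℝ} (hx : IsConfig N p x) (m j : ℤ) :
    IsConfig N p (fun i => x (i + m) + j) := by
  intro i
  have := hx (i + m)
  rw [add_right_comm] at this
  simp only [this]; ring

theorem IsConfig.add_nat_mul {N : ℕ} {p : ℤ} {x : ℤ → ℝ} (hx : IsConfig N p x) (i : ℤ) (k : ℕ) :
    x (i + k * N) = x i + k * p := by
  induction k with
  | zero => simp
  | succ k ih =>
    have := hx (i + k * N)
    push_cast
    rw [add_mul, one_mul, ← add_assoc, this, ih]; ring

namespace AnnulusTwistMap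

section Minimizers

variable (F : AnnulusTwistMap)

/-- The action of the `N` consecutive steps of `x` starting at index `s`. -/
def totalAction (N : ℕ) (x : ℤ → ℝ) (s : ℤ) : ℝ :=
  ∑ k ∈ Finset.range N, F.action (x (s + k)) (x (s + k + 1))

/-- Action minimizers among the configurations of type `(p, N)`. -/
def IsMinimizer (N : ℕ) (p : ℤ) (x : ℤ → ℝ) : Prop :=
  IsConfig N p x ∧ ∀ u, IsConfig N p u → F.totalAction N x 0 ≤ F.totalAction N u 0

variable {F}

theorem totalAction_add_one {N : ℕ} {p : ℤ} {x : ℤ → ℝ} (hx : IsConfig N p x) (s : ℤ) :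
    F.totalAction N x (s + 1) = F.totalAction N x s := by
  have h1 := Finset.sum_range_succ (fun k : ℕ => F.action (x (s + k)) (x (s + k + 1))) N
  have h2 := Finset.sum_range_succ' (fun k : ℕ => F.action (x (s + k)) (x (s + k + 1))) N
  have h3 : F.action (x (s + N)) (x (s + N + 1)) = F.action (x s) (x (s + 1)) := by
    have e : s + N + 1 = (s + 1) + N := by ring
    rw [hx s, e, hx (s + 1), F.action_add_int]
  have h4 : F.totalAction N x (s + 1) = ∑ k ∈ Finset.range N,
      F.action (x (s + ((k + 1 : ℕ) : ℤ))) (x (s + ((k + 1 : ℕ) : ℤ) + 1)) := by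
    refine Finset.sum_congr rfl fun k _ => ?_
    have e : s + 1 + (k:ℤ) = s + ((k + 1 : ℕ) : ℤ) := by push_cast; ring
    rw [e]
  have h5 : F.totalAction N x s =
    ∑ k ∈ Finset.range N, F.action (x (s + k)) (x (s + k + 1)) := rfl
  simp only [Nat.cast_zero, add_zero] at h2
  linarith

theorem totalAction_eq {N : ℕ} {p : ℤ} {x : ℤ → ℝ} (hx : IsConfig N p x) (s : ℤ) :
    F.totalAction N x s = F.totalAction N x 0 := by
  induction s using Int.induction_on with
  | zero => rfl
  | succ i ih => rw [totalAction_add_one hx, ih]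
  | pred i ih => rw [← ih, ← totalAction_add_one hx (-i - 1)]; congr 1; ring

theorem totalAction_shift {N : ℕ} {p : ℤ} {x : ℤ → ℝ} (hx : IsConfig N p x) (m j : ℤ) :
    F.totalAction N (fun i => x (i + m) + j) 0 = F.totalAction N x 0 := by
  rw [← totalAction_eq hx m]
  refine Finset.sum_congr rfl fun k _ => ?_
  rw [F.action_add_int]
  congr 2 <;> ring

theorem IsMinimizer.shift {N : ℕ} {p : ℤ} {x : ℤ → ℝ} (hx : F.IsMinimizer N p x) (m j : ℤ) :
    F.IsMinimizer N p (fun i => x (i + m) + j) :=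
  ⟨hx.1.shift m j, fun u hu => by rw [totalAction_shift hx.1]; exact hx.2 u hu⟩

theorem action_le_totalAction {N : ℕ} (hN : 0 < N) (x : ℤ → ℝ) (s : ℤ) :
    F.action (x s) (x (s + 1)) ≤ F.totalAction N x s := by
  have := Finset.single_le_sum (f := fun k : ℕ => F.action (x (s + k)) (x (s + k + 1)))
    (fun k _ => F.action_nonneg _ _) (Finset.mem_range.2 hN)
  simpa [totalAction] using this

section Existence

variable {c : ℝ} (hd : ∀ p ∈ Ann, p.1 ≤ (F.f p).1 ∧ (F.f p).1 ≤ p.1 + c)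

include hd

theorem exists_bound_step {N : ℕ} (hN : 0 < N) (p : ℤ) (W : ℝ) : ∃ D : ℝ, 0 ≤ D ∧
    ∀ x, IsConfig N p x → F.totalAction N x 0 ≤ W → ∀ j, |x (j + 1) - x j| ≤ D := by
  refine ⟨|(p:ℝ)| + N * |W + c|, by positivity, fun x hx hW => ?_⟩
  have up : ∀ j, x (j + 1) - x j ≤ |W + c| := by
    intro j
    have h1 := le_action hd (x j) (x (j + 1))
    have h2 := action_le_totalAction (F := F) hN x j
    rw [totalAction_eq hx] at h2
    linarith [le_abs_self (W + c)]
  have upn : ∀ (n : ℕ) (j : ℤ), x (j + n) - x j ≤ n * |W + c| := by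
    intro n j
    induction n with
    | zero => simp
    | succ n ih =>
      have := up (j + n)
      push_cast
      rw [← add_assoc]
      linarith
  intro j
  have h1 := upn (N - 1) (j + 1)
  have e : j + 1 + ((N - 1 : ℕ) : ℤ) = j + N := by push_cast [Nat.cast_sub hN]; ring
  rw [e, hx j, Nat.cast_sub hN] at h1
  have hN1 : (1:ℝ) ≤ N := by exact_mod_cast hN
  have h0 := abs_nonneg (W + c)
  push_cast at h1
  rw [abs_le]
  constructor
  · nlinarith [neg_abs_le (p:ℝ)]
  · nlinarith [up j, abs_nonneg (p:ℝ)]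

theorem exists_isMinimizer {N : ℕ} (hN : 0 < N) (p : ℤ) :
    ∃ x, F.IsMinimizer N p x ∧ x 0 ∈ Set.Icc (0:ℝ) 1 := by
  set x₀ : ℤ → ℝ := fun i => i * p / N with hx₀
  have hN0 : (N:ℝ) ≠ 0 := by positivity
  have hc₀ : IsConfig N p x₀ := by
    intro i
    simp only [hx₀]; push_cast; field_simp
  obtain ⟨D, hD0, hD⟩ := exists_bound_step hd hN p (F.totalAction N x₀ 0)
  set T : Set (ℤ → ℝ) :=
    {x | IsConfig N p x ∧ x 0 ∈ Set.Icc (0:ℝ) 1 ∧ ∀ j, |x (j + 1) - x j| ≤ D} with hT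
  have hTclosed : IsClosed T := by
    have e : T = {x : ℤ → ℝ | ∀ i : ℤ, x (i + N) = x i + p} ∩ ({x | x 0 ∈ Set.Icc (0:ℝ) 1} ∩
      {x | ∀ j, |x (j + 1) - x j| ≤ D}) := rfl
    rw [e]
    refine IsClosed.inter ?_ (IsClosed.inter ?_ ?_)
    · simp only [ofPred_forall]
      exact isClosed_iInter fun i => isClosed_eq (by fun_prop) (by fun_prop)
    · exact isClosed_Icc.preimage (continuous_apply 0)
    · simp only [ofPred_forall]
      exact isClosed_iInter fun i => isClosed_le (by fun_prop) (by fun_prop)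
  have hTsub : T ⊆ Set.univ.pi (fun i : ℤ => Set.Icc (-(1 + |(i:ℝ)| * D)) (1 + |(i:ℝ)| * D)) := by
    rintro x ⟨-, h0, hs⟩ i -
    have hn : ∀ (n : ℕ) (s : ℤ), |x (s + n) - x s| ≤ n * D := by
      intro n s
      induction n with
      | zero => simp
      | succ n ih =>
        have h1 := hs (s + n)
        push_cast
        rw [abs_le] at *
        rw [← add_assoc]
        constructor <;> linarith
    have hb : |x i - x 0| ≤ |(i:ℝ)| * D := by
      obtain ⟨n, rfl | rfl⟩ := i.eq_nat_or_neg
      · simpa using hn n 0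
      · have := hn n (-n)
        rw [abs_sub_comm]
        simpa using this
    rw [abs_le] at hb
    exact ⟨by linarith [h0.1, hb.1], by linarith [h0.2, hb.2]⟩
  have hTcomp : IsCompact T :=
    (isCompact_univ_pi fun i => isCompact_Icc).of_isClosed_subset hTclosed hTsub
  have hcont : Continuous (fun x : ℤ → ℝ => F.totalAction N x 0) := by
    refine continuous_finsetSum _ fun k _ => ?_
    exact (continuous_action hd).comp (by fun_prop :
      Continuous fun x : ℤ → ℝ => (x (0 + k), x (0 + k + 1)))
  have hx₀T : x₀ ∈ T := ⟨hc₀, by simp [hx₀], hD x₀ hc₀ le_rfl⟩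
  obtain ⟨x, hxT, hmin⟩ := hTcomp.exists_isMinOn ⟨x₀, hx₀T⟩ hcont.continuousOn
  rw [isMinOn_iff] at hmin
  refine ⟨x, ⟨hxT.1, fun u hu => ?_⟩, hxT.2.1⟩
  rcases le_or_gt (F.totalAction N u 0) (F.totalAction N x₀ 0) with h | h
  · have hv := hu.shift 0 (-⌊u 0⌋)
    have hvW := totalAction_shift (F := F) hu 0 (-⌊u 0⌋)
    rw [← hvW]
    refine hmin _ ⟨hv, ?_, hD _ hv (by rw [hvW]; exact h)⟩
    simp only [add_zero]
    push_cast
    exact ⟨by linarith [Int.floor_le (u 0)], by linarith [Int.lt_floor_add_one (u 0)]⟩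
  · exact (hmin _ hx₀T).trans h.le

end Existence

theorem IsMinimizer.three_point {N : ℕ} (hN : 2 ≤ N) {p : ℤ} {x : ℤ → ℝ}
    (hx : F.IsMinimizer N p x) (i : ℤ) (t : ℝ) :
    F.action (x i) (x (i + 1)) + F.action (x (i + 1)) (x (i + 2)) ≤
      F.action (x i) t + F.action t (x (i + 2)) := by
  have main : ∀ x, F.IsMinimizer N p x → F.action (x 0) (x 1) + F.action (x 1) (x 2) ≤
      F.action (x 0) t + F.action t (x 2) := by
    intro x hx
    set u : ℤ → ℝ := fun i => if i % N = 1 then x i + (t - x 1) else x i with hu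
    have huc : IsConfig N p u := by
      intro i
      simp only [hu, Int.add_emod_right, hx.1 i]
      split_ifs <;> ring
    have h := hx.2 u huc
    obtain ⟨M, rfl⟩ := Nat.exists_eq_add_of_le' hN
    have hval : ∀ j : ℕ, 2 ≤ j → j ≤ M + 2 → u j = x j := by
      intro j h2 hj
      have : ¬ ((j:ℤ) % ((M + 2 : ℕ) : ℤ) = 1) := by
        rcases hj.eq_or_lt with rfl | hlt
        · simp
        · rw [Int.emod_eq_of_lt (by positivity) (by exact_mod_cast hlt)]
          omega
      simp only [hu, if_neg this]
    have h0 : u 0 = x 0 := by simp [hu]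
    have h1 : u 1 = t := by
      have : (1:ℤ) % ((M + 2 : ℕ) : ℤ) = 1 :=
        Int.emod_eq_of_lt (by norm_num) (by push_cast; omega)
      simp only [hu, if_pos this]; ring
    have hu2 : u 2 = x 2 := by exact_mod_cast hval 2 le_rfl (by omega)
    have split : ∀ v : ℤ → ℝ, F.totalAction (M + 2) v 0 =
        (∑ k ∈ Finset.range M, F.action (v ((k + 2 : ℕ) : ℤ)) (v ((k + 3 : ℕ) : ℤ))) +
          F.action (v 1) (v 2) + F.action (v 0) (v 1) := by
      intro v
      rw [totalAction, Finset.sum_range_succ', Finset.sum_range_succ']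
      congr 1
      congr 1
      · refine Finset.sum_congr rfl fun k _ => ?_
        congr 2 <;> push_cast <;> ring
    rw [split, split, h0, h1, hu2] at h
    have hs : ∑ k ∈ Finset.range M, F.action (u ((k + 2 : ℕ) : ℤ)) (u ((k + 3 : ℕ) : ℤ)) =
        ∑ k ∈ Finset.range M, F.action (x ((k + 2 : ℕ) : ℤ)) (x ((k + 3 : ℕ) : ℤ)) := by
      refine Finset.sum_congr rfl fun k hk => ?_
      have := Finset.mem_range.1 hk
      rw [hval (k + 2) (by omega) (by omega), hval (k + 3) (by omega) (by omega)]
    rw [hs] at h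
    linarith
  have := main _ (hx.shift i 0)
  simpa [add_comm] using this

end Minimizers

section EulerLagrange

variable {F : AnnulusTwistMap} {c : ℝ}
  (hd : ∀ p ∈ Ann, p.1 ≤ (F.f p).1 ∧ (F.f p).1 ≤ p.1 + c) {a t₀ b : ℝ}
  (hmin : ∀ t, F.action a t₀ + F.action t₀ b ≤ F.action a t + F.action t b)

include hd hmin

theorem critical_right {η' η : ℝ} (hη' : η' ∈ Set.Icc (0:ℝ) 1) (hη : η ∈ Set.Icc (0:ℝ) 1)
    (h : η' < η) (h1 : b < (F.f (t₀, η')).1) : (F.finv (t₀, η)).1 ≤ a := by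
  by_contra! h2
  have c1 : Continuous (fun s : ℝ => (F.f (s, η')).1) :=
    F.continuousOn_f_fst.comp_continuous (by fun_prop) (fun x => hη')
  have c2 : Continuous (fun s : ℝ => (F.finv (s, η)).1) :=
    F.continuousOn_inv_fst.comp_continuous (by fun_prop) (fun x => hη)
  obtain ⟨ε, hε, he⟩ := Metric.eventually_nhds_iff.1
    ((c1.continuousAt.eventually_const_lt h1).and (c2.continuousAt.eventually_const_lt h2))
  have hs : ∀ s ∈ Set.Icc (t₀ - ε / 2) t₀, b < (F.f (s, η')).1 ∧ a < (F.finv (s, η)).1 := by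
    intro s hs
    refine he ?_
    rw [Real.dist_eq, abs_lt]
    constructor <;> linarith [hs.1, hs.2]
  have i1 := action_sub_left_le hd (x := t₀ - ε / 2) (a := t₀) (x' := b) (by linarith) hη'
    (fun s h => Or.inr (hs s h).1)
  have i2 := le_action_sub_right hd (x' := t₀ - ε / 2) (a' := t₀) (x := a) (by linarith) hη
    (fun s h => (hs s h).2.le)
  have := hmin (t₀ - ε / 2)
  nlinarith

theorem critical_left {η' η : ℝ} (hη' : η' ∈ Set.Icc (0:ℝ) 1) (hη : η ∈ Set.Icc (0:ℝ) 1)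
    (h : η' < η) (h1 : (F.finv (t₀, η')).1 < a) : b ≤ (F.f (t₀, η)).1 := by
  by_contra! h2
  have c1 : Continuous (fun s : ℝ => (F.finv (s, η')).1) :=
    F.continuousOn_inv_fst.comp_continuous (by fun_prop) (fun x => hη')
  have c2 : Continuous (fun s : ℝ => (F.f (s, η)).1) :=
    F.continuousOn_f_fst.comp_continuous (by fun_prop) (fun x => hη)
  obtain ⟨ε, hε, he⟩ := Metric.eventually_nhds_iff.1
    ((c1.continuousAt.eventually_lt_const h1).and (c2.continuousAt.eventually_lt_const h2))
  have hs : ∀ s ∈ Set.Icc t₀ (t₀ + ε / 2), (F.finv (s, η')).1 < a ∧ (F.f (s, η)).1 < b := by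
    intro s hs
    refine he ?_
    rw [Real.dist_eq, abs_lt]
    constructor <;> linarith [hs.1, hs.2]
  have i1 := action_sub_right_le hd (x' := t₀) (a' := t₀ + ε / 2) (x := a) (by linarith) hη'
    (fun s h => Or.inr (hs s h).1)
  have i2 := le_action_sub_left hd (x := t₀) (a := t₀ + ε / 2) (x' := b) (by linarith) hη
    (fun s h => (hs s h).2.le)
  have := hmin (t₀ + ε / 2)
  nlinarith

theorem top_propagates (h : (F.f (a, 1)).1 ≤ t₀) : (F.f (t₀, 1)).1 ≤ b := by
  have m1 : (1:ℝ) ∈ Set.Icc (0:ℝ) 1 := by simp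
  have h1 : a ≤ (F.finv (t₀, 1)).1 := by
    by_contra! hlt
    have hq : F.finv (t₀, 1) ∈ Ann := F.maps_inv (mk_mem_Ann.2 m1)
    have e : (F.f (F.finv (t₀, 1))).1 = t₀ := by rw [F.right_inv _ (mk_mem_Ann.2 m1)]
    have i1 := F.strictMono_boundary m1 F.top hlt
    have i2 := (F.strictMonoOn_fst (F.finv (t₀, 1)).1).monotoneOn hq m1 hq.2
    simp only at i1 i2
    linarith
  have h2 : ∀ η' ∈ Set.Ioo (0:ℝ) 1, (F.f (t₀, η')).1 ≤ b := by
    intro η' hη'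
    by_contra! hb
    obtain ⟨η, g1, g2⟩ := exists_between hη'.2
    have mη : η ∈ Set.Icc (0:ℝ) 1 := ⟨by linarith [hη'.1], g2.le⟩
    have := critical_right hd hmin (Ioo_subset_Icc_self hη') mη g1 hb
    have := F.strictAntiOn_inv_fst t₀ mη m1 g2
    simp only at this
    linarith
  refine le_on_closure (s := Set.Ioo (0:ℝ) 1) (f := fun y => (F.f (t₀, y)).1)
    (g := fun _ => b) h2 ?_ continuousOn_const ?_
  · rw [closure_Ioo zero_ne_one]
    exact continuousOn_vertical F.continuousOn_f_fst t₀
  · rw [closure_Ioo zero_ne_one]; exact m1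

theorem bottom_propagates (h : t₀ ≤ (F.f (a, 0)).1) : b ≤ (F.f (t₀, 0)).1 := by
  have m0 : (0:ℝ) ∈ Set.Icc (0:ℝ) 1 := by simp
  have h1 : (F.finv (t₀, 0)).1 ≤ a := by
    by_contra! hlt
    have hq : F.finv (t₀, 0) ∈ Ann := F.maps_inv (mk_mem_Ann.2 m0)
    have e : (F.f (F.finv (t₀, 0))).1 = t₀ := by rw [F.right_inv _ (mk_mem_Ann.2 m0)]
    have i1 := F.strictMono_boundary m0 F.bottom hlt
    have i2 := (F.strictMonoOn_fst (F.finv (t₀, 0)).1).monotoneOn m0 hq hq.1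
    simp only at i1 i2
    linarith
  have h2 : ∀ η ∈ Set.Ioo (0:ℝ) 1, b ≤ (F.f (t₀, η)).1 := by
    intro η hη
    obtain ⟨η', g1, g2⟩ := exists_between hη.1
    have mη : η' ∈ Set.Icc (0:ℝ) 1 := ⟨g1.le, by linarith [hη.2]⟩
    refine critical_left hd hmin mη (Ioo_subset_Icc_self hη) g2 ?_
    have := F.strictAntiOn_inv_fst t₀ m0 mη g1
    simp only at this
    linarith
  refine le_on_closure (s := Set.Ioo (0:ℝ) 1) (f := fun _ => b)
    (g := fun y => (F.f (t₀, y)).1) h2 continuousOn_const ?_ ?_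
  · rw [closure_Ioo zero_ne_one]
    exact continuousOn_vertical F.continuousOn_f_fst t₀
  · rw [closure_Ioo zero_ne_one]; exact m0

theorem inv_fst_eq_of_fst_eq {η : ℝ} (hη : η ∈ Set.Ioo (0:ℝ) 1) (h : (F.f (t₀, η)).1 = b) :
    (F.finv (t₀, η)).1 = a := by
  have mη := Ioo_subset_Icc_self hη
  have hc := continuousOn_vertical F.continuousOn_inv_fst t₀
  apply le_antisymm
  · refine le_on_closure (s := Set.Ioo η 1) (f := fun y => (F.finv (t₀, y)).1)
      (g := fun _ => a) ?_ ?_ continuousOn_const ?_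
    · intro y hy
      obtain ⟨η', g1, g2⟩ := exists_between hy.1
      have m' : η' ∈ Set.Icc (0:ℝ) 1 := ⟨by linarith [hη.1], by linarith [hy.2]⟩
      refine critical_right hd hmin m' ⟨by linarith [hη.1], hy.2.le⟩ g2 ?_
      rw [← h]
      exact F.strictMonoOn_fst t₀ mη m' g1
    · rw [closure_Ioo hη.2.ne]
      exact hc.mono (Set.Icc_subset_Icc_left hη.1.le)
    · rw [closure_Ioo hη.2.ne]; exact ⟨le_rfl, hη.2.le⟩
  · refine le_on_closure (s := Set.Ioo 0 η) (g := fun y => (F.finv (t₀, y)).1)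
      (f := fun _ => a) ?_ continuousOn_const ?_ ?_
    · intro y hy
      obtain ⟨η', g1, g2⟩ := exists_between hy.2
      have m' : η' ∈ Set.Icc (0:ℝ) 1 := ⟨by linarith [hy.1], by linarith [hη.2]⟩
      by_contra! hlt
      have i1 := critical_left hd hmin ⟨hy.1.le, by linarith [hη.2]⟩ m' g1 hlt
      have i2 := F.strictMonoOn_fst t₀ m' mη g2
      simp only at i2
      linarith
    · rw [closure_Ioo hη.1.ne]
      exact hc.mono (Set.Icc_subset_Icc_right hη.2.le)
    · rw [closure_Ioo hη.1.ne]; exact ⟨hη.1.le, le_rfl⟩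

end EulerLagrange

end AnnulusTwistMap

theorem mul_le_of_tendsto_div {u : ℕ → ℝ} {ω C q : ℝ} {N : ℕ} (hN : 0 < N)
    (h : Tendsto (fun n : ℕ => u n / n) atTop (𝓝 ω)) (hb : ∀ k : ℕ, u (k * N) ≤ C + k * q) :
    N * ω ≤ q := by
  have hN0 : (N:ℝ) ≠ 0 := by positivity
  have t1 : Tendsto (fun k : ℕ => k * N) atTop atTop :=
    tendsto_atTop_mono (fun k => Nat.le_mul_of_pos_right k hN) tendsto_id
  have t2 := (h.comp t1).const_mul (N:ℝ)
  have t3 : Tendsto (fun k : ℕ => C / (k:ℝ) + q) atTop (𝓝 (0 + q)) :=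
    (tendsto_const_div_atTop_nhds_zero_nat C).add tendsto_const_nhds
  rw [zero_add] at t3
  refine le_of_tendsto_of_tendsto t2 t3 ?_
  filter_upwards [eventually_gt_atTop 0] with k hk
  have hk0 : (0:ℝ) < k := by exact_mod_cast hk
  have := hb k
  simp only [Function.comp_apply]
  push_cast
  rw [show (N:ℝ) * (u (k * N) / (k * N)) = u (k * N) / k by field_simp, div_add' _ _ _ hk0.ne',
    div_le_div_iff_of_pos_right hk0]
  linarith

theorem le_mul_of_tendsto_div {u : ℕ → ℝ} {ω C q : ℝ} {N : ℕ} (hN : 0 < N)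
    (h : Tendsto (fun n : ℕ => u n / n) atTop (𝓝 ω)) (hb : ∀ k : ℕ, C + k * q ≤ u (k * N)) :
    q ≤ N * ω := by
  have h' : Tendsto (fun n : ℕ => (-u n) / n) atTop (𝓝 (-ω)) := by
    simpa [neg_div] using h.neg
  have := mul_le_of_tendsto_div (C := -C) (q := -q) hN h' fun k => by linarith [hb k]
  linarith

namespace AnnulusTwistMap

/-- The points `(x i, y i)`, `i ∈ ℤ`, form a full orbit of `F` in the annulus. -/
def IsOrbit (F : AnnulusTwistMap) (x y : ℤ → ℝ) : Prop :=
  ∀ i, y i ∈ Set.Icc (0:ℝ) 1 ∧ F.f (x i, y i) = (x (i + 1), y (i + 1))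

section Orbits

variable {F : AnnulusTwistMap} {x y u v : ℤ → ℝ}

theorem IsOrbit.mem (h : F.IsOrbit x y) (i : ℤ) : (x i, y i) ∈ Ann := (h i).1

theorem IsOrbit.finv_eq (h : F.IsOrbit x y) (i : ℤ) :
    F.finv (x (i + 1), y (i + 1)) = (x i, y i) := by
  rw [← (h i).2, F.left_inv _ (h.mem i)]

theorem IsOrbit.shift (h : F.IsOrbit x y) (m j : ℤ) :
    F.IsOrbit (fun i => x (i + m) + j) (fun i => y (i + m)) := by
  intro i
  refine ⟨(h _).1, ?_⟩
  have := F.map_add_int _ (h.mem (i + m)) j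
  rw [(h (i + m)).2] at this
  simpa [add_right_comm] using this

theorem IsOrbit.eq_succ_of_le (hx : F.IsOrbit x y) (hu : F.IsOrbit u v) (hle : ∀ i, x i ≤ u i)
    {i : ℤ} (h : u i = x i) : u (i + 1) = x (i + 1) := by
  have hy : y i ≤ v i := by
    refine ((F.strictMonoOn_fst (x i)).le_iff_le (hx i).1 (hu i).1).1 ?_
    have := (hu i).2
    rw [h] at this
    simpa only [(hx i).2, this] using hle (i + 1)
  have hv : v i ≤ y i := by
    refine ((F.strictAntiOn_inv_fst (x i)).le_iff_ge (hx i).1 (hu i).1).1 ?_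
    have e1 := hx.finv_eq (i - 1)
    have e2 := hu.finv_eq (i - 1)
    rw [sub_add_cancel] at e1 e2
    rw [h] at e2
    simpa only [e1, e2] using hle (i - 1)
  have := (hu i).2
  rw [h, le_antisymm hv hy, (hx i).2] at this
  exact (congrArg Prod.fst this).symm

end Orbits

section MinimizersAreOrbits

variable {F : AnnulusTwistMap} {c ωm ωp : ℝ}
  (hd : ∀ p ∈ Ann, p.1 ≤ (F.f p).1 ∧ (F.f p).1 ≤ p.1 + c) {N : ℕ} {p : ℤ} {x : ℤ → ℝ}

include hd

theorem IsMinimizer.lt_fst_top (htop : ∀ x : ℝ, HasRotNum F (x, 1) ωp) (hN : 2 ≤ N)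
    (hp : (p:ℝ) < N * ωp) (hx : F.IsMinimizer N p x) (i : ℤ) : x (i + 1) < (F.f (x i, 1)).1 := by
  by_contra! h
  have h1 : ∀ n : ℕ, (F.f (x (i + n), 1)).1 ≤ x (i + n + 1) := by
    intro n
    induction n with
    | zero => simpa using h
    | succ n ih =>
      have := top_propagates hd (hx.three_point hN (i + n)) ih
      push_cast
      convert this using 2 <;> ring_nf
  have mono := (F.strictMono_boundary (by simp) F.top).monotone
  have h2 : ∀ n : ℕ, (fun x => (F.f (x, 1)).1)^[n] (x i) ≤ x (i + n) := by
    intro n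
    induction n with
    | zero => simp
    | succ n ih =>
      rw [Function.iterate_succ_apply']
      push_cast
      rw [← add_assoc]
      exact (mono ih).trans (h1 n)
  have := mul_le_of_tendsto_div (C := x i) (q := p) (N := N) (by omega) (htop (x i)) fun k => by
    rw [F.iterate_boundary F.top]
    refine (h2 _).trans (le_of_eq ?_)
    push_cast
    exact hx.1.add_nat_mul i k
  linarith

theorem IsMinimizer.fst_bottom_lt (hbot : ∀ x : ℝ, HasRotNum F (x, 0) ωm) (hN : 2 ≤ N)
    (hp : N * ωm < p) (hx : F.IsMinimizer N p x) (i : ℤ) : (F.f (x i, 0)).1 < x (i + 1) := by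
  by_contra! h
  have h1 : ∀ n : ℕ, x (i + n + 1) ≤ (F.f (x (i + n), 0)).1 := by
    intro n
    induction n with
    | zero => simpa using h
    | succ n ih =>
      have := bottom_propagates hd (hx.three_point hN (i + n)) ih
      push_cast
      convert this using 2 <;> ring_nf
  have mono := (F.strictMono_boundary (by simp) F.bottom).monotone
  have h2 : ∀ n : ℕ, x (i + n) ≤ (fun x => (F.f (x, 0)).1)^[n] (x i) := by
    intro n
    induction n with
    | zero => simp
    | succ n ih =>
      rw [Function.iterate_succ_apply']
      push_cast
      rw [← add_assoc]
      exact (h1 n).trans (mono ih)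
  have := le_mul_of_tendsto_div (C := x i) (q := p) (N := N) (by omega) (hbot (x i)) fun k => by
    rw [F.iterate_boundary F.bottom]
    refine (le_of_eq ?_).trans (h2 _)
    push_cast
    exact (hx.1.add_nat_mul i k).symm
  linarith

theorem IsMinimizer.exists_isOrbit (hbot : ∀ x : ℝ, HasRotNum F (x, 0) ωm)
    (htop : ∀ x : ℝ, HasRotNum F (x, 1) ωp) (hN : 2 ≤ N) (hpm : N * ωm < p)
    (hpp : (p:ℝ) < N * ωp) (hx : F.IsMinimizer N p x) : ∃ y, F.IsOrbit x y := by
  have h : ∀ i, ∃ η ∈ Set.Ioo (0:ℝ) 1, (F.f (x i, η)).1 = x (i + 1) := fun i =>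
    intermediate_value_Ioo zero_le_one (continuousOn_vertical F.continuousOn_f_fst (x i))
      ⟨hx.fst_bottom_lt hd hbot hN hpm i, hx.lt_fst_top hd htop hN hpp i⟩
  choose y hy hfy using h
  refine ⟨y, fun i => ⟨Ioo_subset_Icc_self (hy i), ?_⟩⟩
  have m := mk_mem_Ann (x := x (i + 1)).2 (Ioo_subset_Icc_self (hy (i + 1)))
  have e : (F.finv (x (i + 1), y (i + 1))).1 = x i := by
    refine inv_fst_eq_of_fst_eq hd (hx.three_point hN i) (hy (i + 1)) ?_
    rw [hfy]; congr 1; ring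
  have hm := F.maps_inv m
  have e2 : F.finv (x (i + 1), y (i + 1)) = (x i, (F.finv (x (i + 1), y (i + 1))).2) := by
    rw [← e]
  have e3 := F.right_inv _ m
  rw [e2] at e3 hm
  have : (F.finv (x (i + 1), y (i + 1))).2 = y i := by
    refine (F.strictMonoOn_fst (x i)).injOn hm (Ioo_subset_Icc_self (hy i)) ?_
    simp only
    rw [e3, hfy]
  rw [← this, e3]

variable (hbot : ∀ x : ℝ, HasRotNum F (x, 0) ωm)
    (htop : ∀ x : ℝ, HasRotNum F (x, 1) ωp) (hN : 2 ≤ N) (hpm : N * ωm < p)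
    (hpp : (p:ℝ) < N * ωp) (hx : F.IsMinimizer N p x) {p' : ℤ} {a : ℤ → ℝ}
    (ha : F.IsMinimizer N p' a) (hp : p' ≤ p)

include hbot htop hN hpm hpp hx ha hp

theorem IsMinimizer.le_of_le_zero (h0 : a 0 ≤ x 0) (i : ℕ) : a i ≤ x i := by
  have hN0 : (N:ℤ) ≠ 0 := by omega
  have hpR : (0:ℝ) ≤ p - p' := by
    rw [sub_nonneg]; exact_mod_cast hp
  set u : ℤ → ℝ := fun i => max (x i) (a i + (p - p') * ((i / (N:ℤ) : ℤ) : ℝ)) with hu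
  set v : ℤ → ℝ := fun i => min (x i - (p - p') * ((i / (N:ℤ) : ℤ) : ℝ)) (a i) with hv
  have huc : IsConfig N p u := by
    intro i
    simp only [hu, hx.1 i, ha.1 i, Int.add_ediv_of_dvd_right (dvd_refl (N:ℤ)),
      Int.ediv_self hN0, ← max_add_add_right]
    push_cast; congr 1; ring
  have hvc : IsConfig N p' v := by
    intro i
    simp only [hv, hx.1 i, ha.1 i, Int.add_ediv_of_dvd_right (dvd_refl (N:ℤ)),
      Int.ediv_self hN0, ← min_add_add_right]
    push_cast; congr 1; ring
  have hu0 : u 0 = x 0 := by simp [hu, h0]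
  have hv0 : v 0 = a 0 := by simp [hv, h0]
  have hval : ∀ k : ℕ, k ≤ N → u k = max (x k) (a k) ∧ v k = min (x k) (a k) := by
    intro k hk
    rcases hk.eq_or_lt with rfl | hlt
    · have e1 := huc 0
      have e2 := hvc 0
      have e3 := hx.1 0
      have e4 := ha.1 0
      rw [zero_add] at e1 e2 e3 e4
      have : a k ≤ x k := by rw [e3, e4]; linarith
      rw [max_eq_left this, min_eq_right this, e1, e2, e3, e4, hu0, hv0]
      exact ⟨rfl, rfl⟩
    · have : (k:ℤ) / (N:ℤ) = 0 := Int.ediv_eq_zero_of_lt (by positivity) (by exact_mod_cast hlt)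
      simp [hu, hv, this]
  have hsum : F.totalAction N u 0 + F.totalAction N v 0 ≤
      F.totalAction N x 0 + F.totalAction N a 0 := by
    simp only [totalAction, ← Finset.sum_add_distrib]
    refine Finset.sum_le_sum fun k hk => ?_
    have hk := Finset.mem_range.1 hk
    obtain ⟨a1, a2⟩ := hval k hk.le
    obtain ⟨b1, b2⟩ := hval (k + 1) hk
    push_cast at b1 b2
    simp only [zero_add, a1, a2, b1, b2]
    exact action_max_add_min hd _ _ _ _
  have humin : F.IsMinimizer N p u :=
    ⟨huc, fun w hw => by linarith [hx.2 w hw, ha.2 v hvc]⟩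
  obtain ⟨y, hy⟩ := hx.exists_isOrbit hd hbot htop hN hpm hpp
  obtain ⟨w, hw⟩ := humin.exists_isOrbit hd hbot htop hN hpm hpp
  have heq : ∀ i : ℕ, u i = x i := by
    intro i
    induction i with
    | zero => simpa using hu0
    | succ i ih =>
      push_cast
      exact hy.eq_succ_of_le hw (fun i => le_max_left _ _) ih
  rw [← heq i]
  refine le_trans ?_ (le_max_right _ _)
  have : (0:ℝ) ≤ (((i:ℤ) / (N:ℤ) : ℤ) : ℝ) :=
    Int.cast_nonneg (Int.ediv_nonneg (Int.natCast_nonneg i) (Int.natCast_nonneg N))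
  nlinarith

/-- Minimizers do not cross in the wrong direction. -/
theorem IsMinimizer.le_of_le {n m j : ℤ} (h : a n + j ≤ x m) (k : ℕ) :
    a (n + k) + j ≤ x (m + k) := by
  have := (hx.shift m 0).le_of_le_zero hd hbot htop hN hpm hpp (ha.shift n j) hp (by simpa using h) k
  simpa [add_comm] using this

theorem IsMinimizer.cone {y b : ℤ → ℝ} (hy : F.IsOrbit x y) (hb : F.IsOrbit a b) {K : ℝ}
    (hK : ∀ p ∈ Ann, ∀ q ∈ Ann, ((F.finv q).1 ≤ (F.finv p).1 → (F.f q).1 ≤ (F.f p).1) →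
      q.2 - p.2 ≤ K * |p.1 - q.1|) (n m j : ℤ) :
    b n - y m ≤ K * |x m - (a n + j)| := by
  have hb' := hb.shift n j
  have hy' := hy.shift m 0
  have e1 := (hy' 0).2
  have e2 := (hb' 0).2
  have e3 := hy'.finv_eq (-1)
  have e4 := hb'.finv_eq (-1)
  have := hK (x m, y m) (hy.mem m) (a n + j, b n) (hb n).1
  simp only [zero_add, Int.cast_zero, add_zero, neg_add_cancel] at e1 e2 e3 e4
  rw [e1, e2, e3, e4] at this
  refine this fun h => ?_
  have := hx.le_of_le hd hbot htop hN hpm hpp ha hp h 2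
  push_cast at this
  rw [show -1 + n + 2 = 1 + n by ring, show -1 + m + 2 = 1 + m by ring] at this
  exact this

end MinimizersAreOrbits

section RotationBound

variable {F : AnnulusTwistMap} {c ωm ωp : ℝ}
  (hd : ∀ p ∈ Ann, p.1 ≤ (F.f p).1 ∧ (F.f p).1 ≤ p.1 + c) {N : ℕ} {p : ℤ} {x : ℤ → ℝ}

include hd

theorem IsMinimizer.rotation_bound (hbot : ∀ x : ℝ, HasRotNum F (x, 0) ωm)
    (htop : ∀ x : ℝ, HasRotNum F (x, 1) ωp) (hN : 2 ≤ N) (hpm : N * ωm < p)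
    (hpp : (p:ℝ) < N * ωp) (hx : F.IsMinimizer N p x) (s : ℤ) (m : ℕ) :
    |x (s + m) - x s - m * (p / N)| ≤ 1 := by
  have hN0 : (0:ℝ) < N := by positivity
  have key := fun n m j => hx.le_of_le hd hbot htop hN hpm hpp hx le_rfl (n := n) (m := m) (j := j)
  have e : x (s + N * m) = x s + m * p := by rw [mul_comm]; exact hx.1.add_nat_mul s m
  have lo : ∀ j : ℤ, x s + j ≤ x (s + m) → (j:ℝ) ≤ m * (p / N) := by
    intro j hj
    have h1 : ∀ r : ℕ, x s + r * j ≤ x (s + r * m) := by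
      intro r
      induction r with
      | zero => simp
      | succ r ih =>
        have := key _ _ _ hj (r * m)
        push_cast at this ⊢
        rw [show s + (m:ℤ) + r * m = s + (r + 1) * m by ring] at this
        linarith
    have := h1 N
    rw [e] at this
    rw [← mul_div_assoc, le_div_iff₀ hN0]
    linarith
  have hi : ∀ j : ℤ, x (s + m) ≤ x s + j → m * ((p:ℝ) / N) ≤ j := by
    intro j hj
    have h1 : ∀ r : ℕ, x (s + r * m) ≤ x s + r * j := by
      intro r
      induction r with
      | zero => simp
      | succ r ih =>
        have := key (s + m) s (-j) (by push_cast; linarith) (r * m)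
        push_cast at this ⊢
        rw [show s + (m:ℤ) + r * m = s + (r + 1) * m by ring] at this
        linarith
    have := h1 N
    rw [e] at this
    rw [← mul_div_assoc, div_le_iff₀ hN0]
    linarith
  have h1 := lo ⌊x (s + m) - x s⌋ (by linarith [Int.floor_le (x (s + m) - x s)])
  have h2 := hi ⌈x (s + m) - x s⌉ (by linarith [Int.le_ceil (x (s + m) - x s)])
  have h3 := Int.lt_floor_add_one (x (s + m) - x s)
  have h4 := Int.ceil_lt_add_one (x (s + m) - x s)
  rw [abs_le]
  constructor <;> linarith

end RotationBound

end AnnulusTwistMap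

/-- An integer approximation of `N * ω` lying strictly between `N * ωm` and `N * ωp`. -/
def innerApprox (ωm ωp : ℝ) (N : ℕ) (ω : ℝ) : ℤ :=
  max (⌊N * ωm⌋ + 1) (min ⌊N * ω⌋ (⌈N * ωp⌉ - 1))

section InnerApprox

variable {ωm ωp : ℝ} {N : ℕ}

theorem lt_innerApprox (ω : ℝ) : N * ωm < innerApprox ωm ωp N ω := by
  have h : ⌊N * ωm⌋ + 1 ≤ innerApprox ωm ωp N ω := le_max_left _ _
  have h' : ((⌊N * ωm⌋ + 1 : ℤ) : ℝ) ≤ innerApprox ωm ωp N ω := by exact_mod_cast h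
  push_cast at h'
  linarith [Int.lt_floor_add_one (N * ωm)]

theorem innerApprox_lt (hN : 2 < N * (ωp - ωm)) (ω : ℝ) : innerApprox ωm ωp N ω < N * ωp := by
  have h1 := Int.ceil_lt_add_one (N * ωp)
  have h2 := Int.floor_le (N * ωm)
  rcases max_choice (⌊N * ωm⌋ + 1) (min ⌊N * ω⌋ (⌈N * ωp⌉ - 1)) with h | h
  · rw [innerApprox, h]; push_cast; linarith
  · have h3 : innerApprox ωm ωp N ω ≤ ⌈N * ωp⌉ - 1 := by
      rw [innerApprox, h]; exact min_le_right _ _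
    have h4 : (innerApprox ωm ωp N ω : ℝ) ≤ ((⌈N * ωp⌉ - 1 : ℤ) : ℝ) := by exact_mod_cast h3
    push_cast at h4
    linarith

theorem innerApprox_mono : Monotone (innerApprox ωm ωp N) := by
  intro ω ω' h
  unfold innerApprox
  gcongr

theorem abs_innerApprox_sub_le {ω : ℝ} (hω : ω ∈ Set.Icc ωm ωp) :
    |innerApprox ωm ωp N ω - N * ω| ≤ 1 := by
  have hN : (0:ℝ) ≤ N := by positivity
  have a1 := mul_le_mul_of_nonneg_left hω.1 hN
  have a2 := mul_le_mul_of_nonneg_left hω.2 hN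
  have h1 := Int.le_ceil (N * ωp)
  have h2 := Int.floor_le (N * ωm)
  have h3 := Int.floor_le (N * ω)
  have h4 := Int.lt_floor_add_one (N * ω)
  have up : innerApprox ωm ωp N ω ≤ max (⌊N * ωm⌋ + 1) ⌊N * ω⌋ :=
    max_le_max le_rfl (min_le_left _ _)
  have lo : min ⌊N * ω⌋ (⌈N * ωp⌉ - 1) ≤ innerApprox ωm ωp N ω := le_max_right _ _
  have up' : (innerApprox ωm ωp N ω : ℝ) ≤ N * ω + 1 := by
    rcases le_max_iff.1 up with h | h
    · have h' : (innerApprox ωm ωp N ω : ℝ) ≤ ((⌊N * ωm⌋ + 1 : ℤ) : ℝ) := by exact_mod_cast h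
      push_cast at h'; linarith
    · have h' : (innerApprox ωm ωp N ω : ℝ) ≤ (⌊N * ω⌋ : ℝ) := by exact_mod_cast h
      linarith
  have lo' : N * ω - 1 ≤ (innerApprox ωm ωp N ω : ℝ) := by
    rcases min_le_iff.1 lo with h | h
    · have h' : (⌊N * ω⌋ : ℝ) ≤ innerApprox ωm ωp N ω := by exact_mod_cast h
      linarith
    · have h' : ((⌈N * ωp⌉ - 1 : ℤ) : ℝ) ≤ innerApprox ωm ωp N ω := by exact_mod_cast h
      push_cast at h'; linarith
  rw [abs_le]
  constructor <;> linarith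

theorem tendsto_innerApprox_div {ω : ℝ} (hω : ω ∈ Set.Icc ωm ωp) :
    Tendsto (fun n : ℕ => (innerApprox ωm ωp n ω : ℝ) / n) atTop (𝓝 ω) := by
  rw [tendsto_iff_dist_tendsto_zero]
  refine squeeze_zero' (Eventually.of_forall fun _ => dist_nonneg) ?_
    (tendsto_one_div_atTop_nhds_zero_nat (𝕜 := ℝ))
  filter_upwards [eventually_gt_atTop 0] with n hn
  have hn0 : (0:ℝ) < n := by exact_mod_cast hn
  have e : (innerApprox ωm ωp n ω : ℝ) / n - ω = (innerApprox ωm ωp n ω - n * ω) / n := by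
    field_simp
  rw [Real.dist_eq, e, abs_div, abs_of_pos hn0]
  exact div_le_div_of_nonneg_right (abs_innerApprox_sub_le hω) hn0.le

end InnerApprox

theorem exists_tendsto_hyperfilter {u : ℕ → ℝ} {a b : ℝ} (h : ∀ n, u n ∈ Set.Icc a b) :
    ∃ l ∈ Set.Icc a b, Tendsto u (hyperfilter ℕ) (𝓝 l) :=
  isCompact_Icc.ultrafilter_le_nhds ((hyperfilter ℕ).map u)
    (le_principal_iff.2 (Eventually.of_forall (f := (hyperfilter ℕ : Filter ℕ)) h))

namespace AnnulusTwistMap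

/-- For every rotation number there is an orbit in the annulus with that rotation number, and all
these orbits satisfy a uniform one-sided cone condition with respect to each other. -/
theorem exists_orbits (F : AnnulusTwistMap) {ωm ωp : ℝ}
    (hbot : ∀ x : ℝ, HasRotNum F (x, 0) ωm) (htop : ∀ x : ℝ, HasRotNum F (x, 1) ωp)
    (h0 : 0 < ωm) (hlt : ωm < ωp) :
    ∃ K : ℝ, 0 ≤ K ∧ ∃ X Y : ℝ → ℤ → ℝ, ∀ ω ∈ Set.Icc ωm ωp, F.IsOrbit (X ω) (Y ω) ∧
      (∀ (s : ℤ) (m : ℕ), |X ω (s + m) - X ω s - m * ω| ≤ 1) ∧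
      ∀ ω' ∈ Set.Icc ωm ωp, ω ≤ ω' → ∀ n m j : ℤ,
        Y ω n - Y ω' m ≤ K * |X ω' m - (X ω n + j)| := by
  obtain ⟨δ, hδ, c, hd'⟩ := F.exists_displacement hbot h0
  have hd : ∀ p ∈ Ann, p.1 ≤ (F.f p).1 ∧ (F.f p).1 ≤ p.1 + c :=
    fun p hp => ⟨by linarith [(hd' p hp).1], (hd' p hp).2⟩
  obtain ⟨K, hK0, hK⟩ := F.exists_cone_const
  obtain ⟨M, hM⟩ := exists_nat_gt (2 / (ωp - ωm))
  have hpos : 0 < ωp - ωm := by linarith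
  have hNbig : ∀ n : ℕ, 2 < ((n + (M + 2) : ℕ) : ℝ) * (ωp - ωm) := by
    intro n
    rw [div_lt_iff₀ hpos] at hM
    push_cast
    nlinarith [(Nat.cast_nonneg n : (0:ℝ) ≤ n)]
  have hN2 : ∀ n : ℕ, 2 ≤ n + (M + 2) := fun n => by omega
  have ex : ∀ (n : ℕ) (ω : ℝ), ∃ x y : ℤ → ℝ,
      F.IsMinimizer (n + (M + 2)) (innerApprox ωm ωp (n + (M + 2)) ω) x ∧
      x 0 ∈ Set.Icc (0:ℝ) 1 ∧ F.IsOrbit x y := by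
    intro n ω
    obtain ⟨x, hx, hx0⟩ := exists_isMinimizer hd (N := n + (M + 2)) (by omega)
      (innerApprox ωm ωp (n + (M + 2)) ω)
    obtain ⟨y, hy⟩ := hx.exists_isOrbit hd hbot htop (hN2 n) (lt_innerApprox ω)
      (innerApprox_lt (hNbig n) ω)
    exact ⟨x, y, hx, hx0, hy⟩
  choose x y hx hx0 hy using ex
  have hrot : ∀ n ω (s : ℤ) (m : ℕ), |x n ω (s + m) - x n ω s -
      m * ((innerApprox ωm ωp (n + (M + 2)) ω : ℝ) / ((n + (M + 2) : ℕ) : ℝ))| ≤ 1 :=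
    fun n ω s m => (hx n ω).rotation_bound hd hbot htop (hN2 n) (lt_innerApprox ω)
      (innerApprox_lt (hNbig n) ω) s m
  have hbd : ∀ ω (i : ℤ) n,
      x n ω i ∈ Set.Icc (-(2 + i.natAbs * ωp)) (2 + i.natAbs * ωp) := by
    intro ω i n
    have hNpos : (0:ℝ) < ((n + (M + 2) : ℕ) : ℝ) := by positivity
    set q : ℝ := (innerApprox ωm ωp (n + (M + 2)) ω : ℝ) / ((n + (M + 2) : ℕ) : ℝ) with hq
    have q1 : ωm ≤ q := by
      rw [hq, le_div_iff₀ hNpos, mul_comm]; exact (lt_innerApprox ω).le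
    have q2 : q ≤ ωp := by
      rw [hq, div_le_iff₀ hNpos, mul_comm]; exact (innerApprox_lt (hNbig n) ω).le
    have hx0 := hx0 n ω
    obtain ⟨m, rfl | rfl⟩ := i.eq_nat_or_neg
    · have h1 := hrot n ω 0 m
      rw [← hq, zero_add, abs_le] at h1
      have hm : (0:ℝ) ≤ m := by positivity
      have h2 := mul_le_mul_of_nonneg_left q2 hm
      have h3 : 0 ≤ m * q := mul_nonneg hm (by linarith)
      simp only [Int.natAbs_natCast]
      constructor <;> linarith [hx0.1, hx0.2]
    · have h1 := hrot n ω (-m) m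
      rw [← hq, neg_add_cancel, abs_le] at h1
      have hm : (0:ℝ) ≤ m := by positivity
      have h2 := mul_le_mul_of_nonneg_left q2 hm
      have h3 : 0 ≤ m * q := mul_nonneg hm (by linarith)
      simp only [Int.natAbs_neg, Int.natAbs_natCast]
      constructor <;> linarith [hx0.1, hx0.2]
  have exX := fun ω (i : ℤ) => exists_tendsto_hyperfilter (hbd ω i)
  have exY := fun ω (i : ℤ) => exists_tendsto_hyperfilter (fun n => (hy n ω i).1)
  choose X _ hX using exX
  choose Y hY01 hY using exY
  refine ⟨K, hK0, X, Y, fun ω hω => ⟨fun i => ⟨hY01 ω i, ?_⟩, fun s m => ?_, ?_⟩⟩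
  · have t1 : Tendsto (fun n => (x n ω i, y n ω i)) (hyperfilter ℕ) (𝓝[Ann] (X ω i, Y ω i)) :=
      tendsto_nhdsWithin_iff.2 ⟨(hX ω i).prodMk_nhds (hY ω i),
        Eventually.of_forall fun n => (hy n ω).mem i⟩
    have t2 := (F.smooth.continuousOn (X ω i, Y ω i) (hY01 ω i)).tendsto.comp t1
    refine tendsto_nhds_unique t2 (((hX ω (i + 1)).prodMk_nhds (hY ω (i + 1))).congr fun n => ?_)
    exact ((hy n ω i).2).symm
  · have t1 : Tendsto (fun n : ℕ => (innerApprox ωm ωp (n + (M + 2)) ω : ℝ) /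
        ((n + (M + 2) : ℕ) : ℝ)) (hyperfilter ℕ) (𝓝 ω) :=
      ((tendsto_innerApprox_div hω).comp (tendsto_add_atTop_nat (M + 2))).mono_left
        Nat.hyperfilter_le_atTop
    exact le_of_tendsto (((hX ω (s + m)).sub (hX ω s)).sub (t1.const_mul (m:ℝ))).abs
      (Eventually.of_forall fun n => hrot n ω s m)
  · intro ω' hω' hle n m j
    refine le_of_tendsto_of_tendsto' ((hY ω n).sub (hY ω' m))
      ((((hX ω' m).sub ((hX ω n).add_const (j:ℝ))).abs).const_mul K) fun k => ?_
    exact (hx k ω').cone hd hbot htop (hN2 k) (lt_innerApprox ω') (innerApprox_lt (hNbig k) ω')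
      (hx k ω) (innerApprox_mono hle) (hy k ω') (hy k ω) hK n m j

end AnnulusTwistMap

/-- The least nonnegative function which is `K`-Lipschitz and lies above the points of `D`. -/
def lowerEnv (K : ℝ) (D : Set (ℝ × ℝ)) (x : ℝ) : ℝ :=
  sSup (insert 0 ((fun q : ℝ × ℝ => q.2 - K * |x - q.1|) '' D))

/-- The vertical reflection of the annulus. -/
def reflect (q : ℝ × ℝ) : ℝ × ℝ := (q.1, 1 - q.2)

/-- The largest function bounded by `1` which is `K`-Lipschitz and lies below the points of `D`. -/
def upperEnv (K : ℝ) (D : Set (ℝ × ℝ)) (x : ℝ) : ℝ := 1 - lowerEnv K (reflect ⁻¹' D) x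

section Envelopes

variable {K : ℝ} {D D' : Set (ℝ × ℝ)} {x v : ℝ}

theorem continuous_reflect : Continuous reflect := by unfold reflect; fun_prop

theorem reflect_reflect (q : ℝ × ℝ) : reflect (reflect q) = q := by simp [reflect]

theorem reflect_mem_Ann {q : ℝ × ℝ} (hq : q ∈ Ann) : reflect q ∈ Ann :=
  ⟨sub_nonneg.2 hq.2, sub_le_self _ hq.1⟩

theorem preimage_reflect_subset_Ann (hD : D ⊆ Ann) : reflect ⁻¹' D ⊆ Ann := fun q hq => by
  rw [← reflect_reflect q]; exact reflect_mem_Ann (hD hq)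

theorem lowerEnv_le (hv : 0 ≤ v) (h : ∀ q ∈ D, q.2 - K * |x - q.1| ≤ v) : lowerEnv K D x ≤ v := by
  refine csSup_le ⟨0, mem_insert _ _⟩ ?_
  rintro _ (rfl | ⟨q, hq, rfl⟩)
  exacts [hv, h q hq]

theorem le_upperEnv (hv : v ≤ 1) (h : ∀ q ∈ D, v ≤ q.2 + K * |x - q.1|) : v ≤ upperEnv K D x := by
  have : lowerEnv K (reflect ⁻¹' D) x ≤ 1 - v :=
    lowerEnv_le (by linarith) fun q hq => by
      have := h _ hq
      simp only [reflect] at this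
      linarith
  unfold upperEnv
  linarith

variable (hK : 0 ≤ K) (hD : D ⊆ Ann)

include hK hD

theorem bddAbove_lowerEnv (x : ℝ) :
    BddAbove (insert 0 ((fun q : ℝ × ℝ => q.2 - K * |x - q.1|) '' D)) := by
  refine ⟨1, ?_⟩
  rintro _ (rfl | ⟨q, hq, rfl⟩)
  · exact zero_le_one
  · have := mul_nonneg hK (abs_nonneg (x - q.1))
    have := (hD hq).2
    simp only
    linarith

theorem lowerEnv_nonneg (x : ℝ) : 0 ≤ lowerEnv K D x :=
  le_csSup (bddAbove_lowerEnv hK hD x) (mem_insert _ _)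

theorem le_lowerEnv {q : ℝ × ℝ} (hq : q ∈ D) (x : ℝ) : q.2 - K * |x - q.1| ≤ lowerEnv K D x :=
  le_csSup (bddAbove_lowerEnv hK hD x) (mem_insert_of_mem _ ⟨q, hq, rfl⟩)

theorem upperEnv_le_one (x : ℝ) : upperEnv K D x ≤ 1 :=
  sub_le_self _ (lowerEnv_nonneg hK (preimage_reflect_subset_Ann hD) x)

theorem upperEnv_le {q : ℝ × ℝ} (hq : q ∈ D) (x : ℝ) : upperEnv K D x ≤ q.2 + K * |x - q.1| := by
  have := le_lowerEnv hK (preimage_reflect_subset_Ann hD) (q := reflect q)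
    (by rwa [mem_preimage, reflect_reflect]) x
  simp only [reflect] at this
  unfold upperEnv
  linarith

theorem lowerEnv_le_add (x x' : ℝ) : lowerEnv K D x ≤ lowerEnv K D x' + K * |x - x'| := by
  refine lowerEnv_le ?_ fun q hq => ?_
  · have := lowerEnv_nonneg hK hD x'
    positivity
  · have h1 := le_lowerEnv hK hD hq x'
    have h2 : |x' - q.1| ≤ |x - x'| + |x - q.1| := by
      rw [abs_sub_comm x x']; exact abs_sub_le x' x q.1
    nlinarith

theorem continuous_lowerEnv : Continuous (lowerEnv K D) :=
  (LipschitzWith.of_le_add_mul (⟨K, hK⟩ : NNReal) fun x x' =>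
    lowerEnv_le_add hK hD x x').continuous

theorem continuous_upperEnv : Continuous (upperEnv K D) :=
  continuous_const.sub (continuous_lowerEnv hK (preimage_reflect_subset_Ann hD))

theorem lowerEnv_add_one (h : ∀ q ∈ D, ∀ j : ℤ, (q.1 + j, q.2) ∈ D) (x : ℝ) :
    lowerEnv K D (x + 1) = lowerEnv K D x := by
  apply le_antisymm
  · refine lowerEnv_le (lowerEnv_nonneg hK hD x) fun q hq => ?_
    have := le_lowerEnv hK hD (h q hq (-1)) x
    rwa [show x - (q.1 + ((-1 : ℤ) : ℝ)) = x + 1 - q.1 by push_cast; ring] at this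
  · refine lowerEnv_le (lowerEnv_nonneg hK hD _) fun q hq => ?_
    have := le_lowerEnv hK hD (h q hq 1) (x + 1)
    rwa [show x + 1 - (q.1 + ((1 : ℤ) : ℝ)) = x - q.1 by push_cast; ring] at this

theorem upperEnv_add_one (h : ∀ q ∈ D, ∀ j : ℤ, (q.1 + j, q.2) ∈ D) (x : ℝ) :
    upperEnv K D (x + 1) = upperEnv K D x :=
  congrArg (1 - ·) (lowerEnv_add_one hK (preimage_reflect_subset_Ann hD)
    (fun q hq j => h (reflect q) hq j) x)

theorem lowerEnv_mono (h : D' ⊆ D) (x : ℝ) : lowerEnv K D' x ≤ lowerEnv K D x :=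
  lowerEnv_le (lowerEnv_nonneg hK hD x) fun _ hq => le_lowerEnv hK hD (h hq) x

theorem upperEnv_anti (h : D' ⊆ D) (x : ℝ) : upperEnv K D x ≤ upperEnv K D' x :=
  sub_le_sub_left (lowerEnv_mono hK (preimage_reflect_subset_Ann hD) (preimage_mono h) x) _

omit hD in
theorem mem_closure_of_le_lowerEnv (hv : 0 < v) (hle : v ≤ lowerEnv (K + 1) D x)
    (h : ∀ q ∈ D, q.2 - K * |x - q.1| ≤ v) : (x, v) ∈ closure D := by
  rw [Metric.mem_closure_iff]
  intro ε hε
  set e := min (ε / (K + 1)) v with he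
  have he0 : 0 < e := by positivity
  have heε : (K + 1) * e ≤ ε := by
    rw [mul_comm, ← le_div_iff₀ (by positivity)]; exact min_le_left _ _
  obtain ⟨w, hw, hlt⟩ := exists_lt_of_lt_csSup (⟨0, mem_insert _ _⟩ :
    (insert 0 ((fun q : ℝ × ℝ => q.2 - (K + 1) * |x - q.1|) '' D)).Nonempty)
    (show v - e < _ from lt_of_lt_of_le (by linarith) hle)
  rcases hw with rfl | ⟨q, hq, rfl⟩
  · linarith [min_le_right (ε / (K + 1)) v]
  · refine ⟨q, hq, ?_⟩
    have h1 := h q hq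
    simp only at hlt
    have h2 : |x - q.1| < e := by linarith
    have h3 := abs_nonneg (x - q.1)
    have h4 : K * |x - q.1| ≤ K * e := mul_le_mul_of_nonneg_left h2.le hK
    have h5 := mul_nonneg hK h3
    have h6 := mul_nonneg hK he0.le
    rw [Prod.dist_eq, Real.dist_eq, Real.dist_eq, max_lt_iff, abs_lt (a := v - q.2)]
    refine ⟨?_, ?_, ?_⟩ <;> linarith

omit hD in
theorem mem_closure_of_upperEnv_le (hv : v < 1) (hle : upperEnv (K + 1) D x ≤ v)
    (h : ∀ q ∈ D, v ≤ q.2 + K * |x - q.1|) : (x, v) ∈ closure D := by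
  have h1 : (x, 1 - v) ∈ closure (reflect ⁻¹' D) := by
    refine mem_closure_of_le_lowerEnv hK (by linarith) ?_ fun q hq => ?_
    · unfold upperEnv at hle; linarith
    · have := h _ hq
      simp only [reflect] at this
      linarith
  simpa [reflect] using continuous_reflect.closure_preimage_subset D h1

end Envelopes

namespace AnnulusTwistMap

section AubryMather

variable {F : AnnulusTwistMap} {x y : ℤ → ℝ}

theorem IsOrbit.iterate_eq (h : F.IsOrbit x y) (i : ℤ) (n : ℕ) :
    (F.f)^[n] (x i, y i) = (x (i + n), y (i + n)) := by
  induction n with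
  | zero => simp
  | succ n ih =>
    rw [Function.iterate_succ_apply', ih, (h _).2]
    push_cast
    rw [add_assoc]

theorem IsOrbit.hasRotNum (h : F.IsOrbit x y) {ω : ℝ}
    (hω : ∀ (s : ℤ) (m : ℕ), |x (s + m) - x s - m * ω| ≤ 1) (i : ℤ) :
    HasRotNum F (x i, y i) ω := by
  unfold HasRotNum
  rw [tendsto_iff_dist_tendsto_zero]
  refine squeeze_zero' (Eventually.of_forall fun _ => dist_nonneg) ?_
    (tendsto_const_div_atTop_nhds_zero_nat (1 + |x i|))
  filter_upwards [eventually_gt_atTop 0] with n hn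
  have hn0 : (0:ℝ) < n := by exact_mod_cast hn
  have e : x (i + n) / n - ω = (x (i + n) - n * ω) / n := by field_simp
  rw [h.iterate_eq, Real.dist_eq, e, abs_div, abs_of_pos hn0]
  refine div_le_div_of_nonneg_right ?_ hn0.le
  have h1 := abs_add_le (x (i + n) - x i - n * ω) (x i)
  have h2 := hω i n
  rw [show x (i + n) - x i - n * ω + x i = x (i + n) - n * ω by ring] at h1
  linarith

theorem IsOrbit.isAubryMather (h : F.IsOrbit x y) {ω δ : ℝ} (hδ : 0 < δ)
    (hdisp : ∀ p ∈ Ann, p.1 + δ ≤ (F.f p).1)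
    (hω : ∀ (s : ℤ) (m : ℕ), |x (s + m) - x s - m * ω| ≤ 1) :
    IsAubryMather F ω (Set.range fun i => (x i, y i)) := by
  have hstep : ∀ i, x i + δ ≤ x (i + 1) := fun i => by
    simpa only [(h i).2] using hdisp _ (h.mem i)
  have hmono : StrictMono x := strictMono_int_of_lt_succ fun i => by linarith [hstep i]
  have hsep : ∀ i j, i < j → δ ≤ x j - x i := fun i j hij => by
    linarith [hstep i, hmono.monotone (Int.add_one_le_iff.2 hij)]
  refine ⟨range_nonempty _, ?_, ?_, ?_, ?_, ?_⟩
  · refine (Metric.isClosedEmbedding_of_pairwise_le_dist hδ fun i j hij => ?_).isClosed_range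
    refine le_trans ?_ (le_max_left _ _)
    rw [Real.dist_eq]
    rcases lt_or_gt_of_ne hij with hl | hl
    · rw [abs_sub_comm]; exact (hsep _ _ hl).trans (le_abs_self _)
    · exact (hsep _ _ hl).trans (le_abs_self _)
  · ext q
    constructor
    · rintro ⟨_, ⟨i, rfl⟩, rfl⟩
      exact ⟨i + 1, (h i).2.symm⟩
    · rintro ⟨i, rfl⟩
      exact ⟨_, ⟨i - 1, rfl⟩, by simpa using (h (i - 1)).2⟩
  · rintro _ ⟨i, rfl⟩ _ ⟨j, rfl⟩ hij
    simp only [(h i).2, (h j).2]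
    exact hmono (by linarith [hmono.lt_iff_lt.1 hij])
  · rintro _ ⟨i, rfl⟩
    exact h.hasRotNum hω i
  · intro S' hS' ⟨q, hq⟩ _ hinv
    refine hS'.antisymm ?_
    have fwd : ∀ i, (x i, y i) ∈ S' → (x (i + 1), y (i + 1)) ∈ S' := fun i hi => by
      rw [← (h i).2, ← hinv]; exact mem_image_of_mem _ hi
    have bwd : ∀ i, (x i, y i) ∈ S' → (x (i - 1), y (i - 1)) ∈ S' := fun i hi => by
      rw [← hinv] at hi
      obtain ⟨r, hr, he⟩ := hi
      obtain ⟨j, rfl⟩ := hS' hr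
      simp only [(h j).2, Prod.mk.injEq] at he
      have := hmono.injective he.1
      rwa [← this, add_sub_cancel_right]
    obtain ⟨i₀, rfl⟩ := hS' hq
    rintro _ ⟨i, rfl⟩
    exact Int.inductionOn' (motive := fun i => (x i, y i) ∈ S') i i₀ hq
      (fun k _ hk => fwd k hk) (fun k _ hk => bwd k hk)

end AubryMather

/-- The integer translates of the orbit points `(X ω n, Y ω n)` with `ω ∈ I`. -/
def orbitPoints (X Y : ℝ → ℤ → ℝ) (I : Set ℝ) : Set (ℝ × ℝ) :=
  {q | ∃ ω ∈ I, ∃ n j : ℤ, q = (X ω n + j, Y ω n)}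

theorem orbitPoints_mono {X Y : ℝ → ℤ → ℝ} {I J : Set ℝ} (h : I ⊆ J) :
    orbitPoints X Y I ⊆ orbitPoints X Y J :=
  fun _ ⟨ω, hω, hq⟩ => ⟨ω, h hω, hq⟩

theorem add_int_mem_orbitPoints {X Y : ℝ → ℤ → ℝ} {I : Set ℝ} {q : ℝ × ℝ}
    (hq : q ∈ orbitPoints X Y I) (k : ℤ) : (q.1 + k, q.2) ∈ orbitPoints X Y I := by
  obtain ⟨ω, hω, n, j, rfl⟩ := hq
  exact ⟨ω, hω, n, j + k, by push_cast; rw [add_assoc]⟩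

section Closure

variable {F : AnnulusTwistMap} {X Y : ℝ → ℤ → ℝ} {I : Set ℝ}
  (horb : ∀ ω ∈ I, F.IsOrbit (X ω) (Y ω))

include horb

theorem orbitPoints_subset_Ann : orbitPoints X Y I ⊆ Ann := by
  rintro _ ⟨ω, hω, n, j, rfl⟩
  exact (horb ω hω n).1

theorem iterate_orbitPoint {ω : ℝ} (hω : ω ∈ I) (i j : ℤ) (n : ℕ) :
    (F.f)^[n] (X ω i + j, Y ω i) = (X ω (i + n) + j, Y ω (i + n)) := by
  have h := ((horb ω hω).shift i j).iterate_eq 0 n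
  simpa [add_comm i] using h

variable (hω : ∀ ω ∈ I, ∀ (s : ℤ) (m : ℕ), |X ω (s + m) - X ω s - m * ω| ≤ 1)

include hω

theorem iterate_fst_le_of_mem_closure {β : ℝ} (hβ : ∀ ω ∈ I, ω ≤ β) {p : ℝ × ℝ}
    (hp : p ∈ closure (orbitPoints X Y I)) (n : ℕ) : ((F.f)^[n] p).1 ≤ p.1 + n * β + 1 := by
  have hsub := closure_minimal (orbitPoints_subset_Ann horb) isClosed_Ann
  refine le_on_closure (s := orbitPoints X Y I) (f := fun p => ((F.f)^[n] p).1)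
    (g := fun p => p.1 + n * β + 1) ?_ ((F.continuousOn_iterate n).fst.mono hsub)
    (by fun_prop) hp
  rintro _ ⟨ω, hI, i, j, rfl⟩
  simp only [iterate_orbitPoint horb hI]
  have h1 := (abs_le.1 (hω ω hI i n)).2
  have h2 := mul_le_mul_of_nonneg_left (hβ ω hI) (Nat.cast_nonneg n)
  linarith

theorem le_iterate_fst_of_mem_closure {β : ℝ} (hβ : ∀ ω ∈ I, β ≤ ω) {p : ℝ × ℝ}
    (hp : p ∈ closure (orbitPoints X Y I)) (n : ℕ) : p.1 + n * β - 1 ≤ ((F.f)^[n] p).1 := by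
  have hsub := closure_minimal (orbitPoints_subset_Ann horb) isClosed_Ann
  refine le_on_closure (s := orbitPoints X Y I) (g := fun p => ((F.f)^[n] p).1)
    (f := fun p => p.1 + n * β - 1) ?_ (by fun_prop) ((F.continuousOn_iterate n).fst.mono hsub) hp
  rintro _ ⟨ω, hI, i, j, rfl⟩
  simp only [iterate_orbitPoint horb hI]
  have h1 := (abs_le.1 (hω ω hI i n)).1
  have h2 := mul_le_mul_of_nonneg_left (hβ ω hI) (Nat.cast_nonneg n)
  linarith

end Closure

end AnnulusTwistMap

open AnnulusTwistMap

/-- **Golé's ordered ghost-circle theorem** (Theorem 4.4): there exists a family of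
essential circles `C_ω = graph (g ω)`, `ω ∈ [ω⁻,ω⁺]`, each the graph of a continuous
periodic function into `[0,1]`, mutually disjoint and vertically ordered by rotation
number, such that each `C_ω` contains an Aubry-Mather set of rotation number `ω`. -/
theorem gole_ordered_circles (F : AnnulusTwistMap) (ωm ωp : ℝ)
    (hbot : ∀ x : ℝ, HasRotNum F (x, 0) ωm)
    (htop : ∀ x : ℝ, HasRotNum F (x, 1) ωp)
    (h0 : 0 < ωm) (hlt : ωm < ωp) :
    ∃ g : ℝ → ℝ → ℝ,
      (∀ ω ∈ Set.Icc ωm ωp,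
        Continuous (g ω) ∧ (∀ x, g ω x ∈ Set.Icc (0:ℝ) 1) ∧ (∀ x, g ω (x + 1) = g ω x)) ∧
      (∀ ω ∈ Set.Icc ωm ωp, ∀ ω' ∈ Set.Icc ωm ωp, ω ≠ ω' →
        torusGraph (g ω) ∩ torusGraph (g ω') = ∅) ∧
      (∀ ω ∈ Set.Icc ωm ωp, ∀ ω' ∈ Set.Icc ωm ωp, ω < ω' → ∀ x, g ω x < g ω' x) ∧
      (∀ ω ∈ Set.Icc ωm ωp, ∃ S : Set (ℝ × ℝ), IsAubryMather F ω S ∧ S ⊆ torusGraph (g ω)) := by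
  obtain ⟨δ, hδ, c, hdisp⟩ := F.exists_displacement hbot h0
  obtain ⟨K, hK, X, Y, hXY⟩ := F.exists_orbits hbot htop h0 hlt
  have hK' : 0 ≤ K + 1 := by linarith
  have hlen : 0 < ωp - ωm := by linarith
  have horb : ∀ ω ∈ Set.Icc ωm ωp, F.IsOrbit (X ω) (Y ω) := fun ω h => (hXY ω h).1
  have hrot : ∀ ω ∈ Set.Icc ωm ωp, ∀ (s : ℤ) (m : ℕ), |X ω (s + m) - X ω s - m * ω| ≤ 1 :=
    fun ω h => (hXY ω h).2.1
  set A : ℝ → Set (ℝ × ℝ) := fun ω => orbitPoints X Y (Set.Icc ωm ω) with hA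
  set B : ℝ → Set (ℝ × ℝ) := fun ω => orbitPoints X Y (Set.Icc ω ωp) with hB
  have hIA : ∀ ω ∈ Set.Icc ωm ωp, Set.Icc ωm ω ⊆ Set.Icc ωm ωp :=
    fun ω h => Set.Icc_subset_Icc_right h.2
  have hIB : ∀ ω ∈ Set.Icc ωm ωp, Set.Icc ω ωp ⊆ Set.Icc ωm ωp :=
    fun ω h => Set.Icc_subset_Icc_left h.1
  have hAnnA : ∀ ω ∈ Set.Icc ωm ωp, A ω ⊆ Ann :=
    fun ω h => orbitPoints_subset_Ann fun α hα => horb α (hIA ω h hα)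
  have hAnnB : ∀ ω ∈ Set.Icc ωm ωp, B ω ⊆ Ann :=
    fun ω h => orbitPoints_subset_Ann fun α hα => horb α (hIB ω h hα)
  have hcone : ∀ ω ∈ Set.Icc ωm ωp, ∀ q ∈ A ω, ∀ r ∈ B ω, q.2 - r.2 ≤ K * |r.1 - q.1| := by
    rintro ω hω _ ⟨α, hα, n, j, rfl⟩ _ ⟨β, hβ, m, k, rfl⟩
    have := (hXY α (hIA ω hω hα)).2.2 β (hIB ω hω hβ) (hα.2.trans hβ.1) n m (j - k)
    rwa [show X β m - (X α n + ((j - k : ℤ) : ℝ)) = X β m + k - (X α n + j) by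
      push_cast; ring] at this
  have htri : ∀ a b x : ℝ, K * |b - a| ≤ K * |x - a| + K * |x - b| := fun a b x => by
    rw [← mul_add]
    refine mul_le_mul_of_nonneg_left ?_ hK
    rw [abs_sub_comm x b, add_comm]
    exact abs_sub_le b x a
  set L : ℝ → ℝ → ℝ := fun ω => lowerEnv (K + 1) (A ω) with hL
  set U : ℝ → ℝ → ℝ := fun ω => upperEnv (K + 1) (B ω) with hU
  have hAU : ∀ ω ∈ Set.Icc ωm ωp, ∀ x, ∀ q ∈ A ω, q.2 - K * |x - q.1| ≤ U ω x := by
    intro ω hω x q hq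
    refine le_upperEnv ?_ fun r hr => ?_
    · have := (hAnnA ω hω hq).2
      have := mul_nonneg hK (abs_nonneg (x - q.1))
      linarith
    · linarith [hcone ω hω q hq r hr, htri q.1 r.1 x, abs_nonneg (x - r.1)]
  have hLB : ∀ ω ∈ Set.Icc ωm ωp, ∀ x, ∀ r ∈ B ω, L ω x ≤ r.2 + K * |x - r.1| := by
    intro ω hω x r hr
    refine lowerEnv_le ?_ fun q hq => ?_
    · have := (hAnnB ω hω hr).1
      have := mul_nonneg hK (abs_nonneg (x - r.1))
      linarith
    · linarith [hcone ω hω q hq r hr, htri q.1 r.1 x, abs_nonneg (x - q.1)]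
  have hL0 : ∀ ω ∈ Set.Icc ωm ωp, ∀ x, 0 ≤ L ω x := fun ω h x =>
    lowerEnv_nonneg hK' (hAnnA ω h) x
  have hU1 : ∀ ω ∈ Set.Icc ωm ωp, ∀ x, U ω x ≤ 1 := fun ω h x =>
    upperEnv_le_one hK' (hAnnB ω h) x
  have hLU : ∀ ω ∈ Set.Icc ωm ωp, ∀ x, L ω x ≤ U ω x := by
    intro ω hω x
    refine lowerEnv_le ?_ fun q hq => ?_
    · exact le_upperEnv zero_le_one fun r hr => add_nonneg (hAnnB ω hω hr).1 (by positivity)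
    · linarith [hAU ω hω x q hq, abs_nonneg (x - q.1)]
  set θ : ℝ → ℝ := fun ω => (ω - ωm) / (ωp - ωm) with hθ
  have hθ0 : ∀ ω ∈ Set.Icc ωm ωp, 0 ≤ θ ω := fun ω h => div_nonneg (by linarith [h.1]) hlen.le
  have hθ1 : ∀ ω ∈ Set.Icc ωm ωp, θ ω ≤ 1 := fun ω h => by
    rw [hθ, div_le_one hlen]; linarith [h.2]
  set g : ℝ → ℝ → ℝ := fun ω x => (1 - θ ω) * L ω x + θ ω * U ω x with hg
  have hlt_g : ∀ ω ∈ Set.Icc ωm ωp, ∀ ω' ∈ Set.Icc ωm ωp, ω < ω' → ∀ x, g ω x < g ω' x := by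
    intro ω hω ω' hω' hlt' x
    by_contra! hle
    have hθlt : θ ω < θ ω' := div_lt_div_of_pos_right (by linarith) hlen
    have m1 : L ω x ≤ L ω' x := lowerEnv_mono hK' (hAnnA ω' hω')
      (orbitPoints_mono (Set.Icc_subset_Icc_right hlt'.le)) x
    have m2 : U ω x ≤ U ω' x := upperEnv_anti hK' (hAnnB ω hω)
      (orbitPoints_mono (Set.Icc_subset_Icc_left hlt'.le)) x
    have m3 := hLU ω hω x
    have m4 := hLU ω' hω' x
    have m5 := hθ0 ω hω
    have m6 := hθ1 ω' hω'
    have e1 : (1 - θ ω) * (L ω' x - L ω x) + θ ω * (U ω' x - U ω x) +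
        (θ ω' - θ ω) * (U ω' x - L ω' x) ≤ 0 := by
      simp only [hg] at hle
      linarith
    have p1 : 0 ≤ (1 - θ ω) * (L ω' x - L ω x) := mul_nonneg (by linarith) (by linarith)
    have p2 : 0 ≤ θ ω * (U ω' x - U ω x) := mul_nonneg m5 (by linarith)
    have p3 : 0 ≤ (θ ω' - θ ω) * (U ω' x - L ω' x) := mul_nonneg (by linarith) (by linarith)
    have q1 : L ω' x ≤ L ω x := by
      have : (1 - θ ω) * (L ω' x - L ω x) ≤ 0 := by linarith
      linarith [nonpos_of_mul_nonpos_right this (by linarith)]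
    have q3 : U ω' x ≤ L ω' x := by
      have : (θ ω' - θ ω) * (U ω' x - L ω' x) ≤ 0 := by linarith
      linarith [nonpos_of_mul_nonpos_right this (by linarith)]
    set v := L ω x with hv
    have hup : v = 0 ∨ ∀ n : ℕ, ((F.f)^[n] (x, v)).1 ≤ x + n * ω + 1 := by
      rcases (hL0 ω hω x).eq_or_lt with h | h
      · exact Or.inl h.symm
      · refine Or.inr fun n => ?_
        refine iterate_fst_le_of_mem_closure (fun α hα => horb α (hIA ω hω hα))
          (fun α hα => hrot α (hIA ω hω hα)) (fun α hα => hα.2)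
          (mem_closure_of_le_lowerEnv hK h le_rfl fun q hq => ?_) n
        linarith [hAU ω hω x q hq]
    have hlo : v = 1 ∨ ∀ n : ℕ, x + n * ω' - 1 ≤ ((F.f)^[n] (x, v)).1 := by
      rcases (show v ≤ 1 by linarith [hU1 ω' hω' x]).eq_or_lt with h | h
      · exact Or.inl h
      · refine Or.inr fun n => ?_
        refine le_iterate_fst_of_mem_closure (fun α hα => horb α (hIB ω' hω' hα))
          (fun α hα => hrot α (hIB ω' hω' hα)) (fun α hα => hα.1)
          (mem_closure_of_upperEnv_le hK h (by linarith) fun q hq => ?_) n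
        linarith [hLB ω' hω' x q hq]
    rcases hup with hv0 | hup
    · rcases hlo with hv1 | hlo
      · linarith
      · rw [hv0] at hlo
        have := le_mul_of_tendsto_div (C := x - 1) (q := ω') one_pos (hbot x) fun k => by
          have := hlo k
          rw [mul_one]; linarith
        norm_num at this
        linarith [hω.1]
    · rcases hlo with hv1 | hlo
      · rw [hv1] at hup
        have := mul_le_of_tendsto_div (C := x + 1) (q := ω) one_pos (htop x) fun k => by
          have := hup k
          rw [mul_one]; linarith
        norm_num at this
        linarith [hω'.2]
      · obtain ⟨n, hn⟩ := exists_nat_gt (2 / (ω' - ω))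
        rw [div_lt_iff₀ (by linarith)] at hn
        linarith [hup n, hlo n]
  have hXA : ∀ ω ∈ Set.Icc ωm ωp, ∀ n, (X ω n, Y ω n) ∈ A ω := fun ω h n =>
    ⟨ω, ⟨h.1, le_rfl⟩, n, 0, by simp⟩
  have hXB : ∀ ω ∈ Set.Icc ωm ωp, ∀ n, (X ω n, Y ω n) ∈ B ω := fun ω h n =>
    ⟨ω, ⟨le_rfl, h.2⟩, n, 0, by simp⟩
  refine ⟨g, fun ω hω => ⟨?_, fun x => ⟨?_, ?_⟩, fun x => ?_⟩, ?_, hlt_g, fun ω hω => ?_⟩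
  · have c1 := continuous_lowerEnv hK' (hAnnA ω hω)
    have c2 := continuous_upperEnv hK' (hAnnB ω hω)
    exact (c1.const_mul _).add (c2.const_mul _)
  · have h1 := hL0 ω hω x
    have h2 := h1.trans (hLU ω hω x)
    exact add_nonneg (mul_nonneg (by linarith [hθ1 ω hω]) h1) (mul_nonneg (hθ0 ω hω) h2)
  · have h2 := hU1 ω hω x
    have h1 := (hLU ω hω x).trans h2
    have := mul_le_mul_of_nonneg_left h1 (sub_nonneg.2 (hθ1 ω hω))
    have := mul_le_mul_of_nonneg_left h2 (hθ0 ω hω)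
    simp only [hg]
    linarith
  · simp only [hg, hL, hU]
    rw [lowerEnv_add_one hK' (hAnnA ω hω) fun q hq j => add_int_mem_orbitPoints hq j,
      upperEnv_add_one hK' (hAnnB ω hω) fun q hq j => add_int_mem_orbitPoints hq j]
  · intro ω hω ω' hω' hne
    refine eq_empty_iff_forall_notMem.2 fun q ⟨h1, h2⟩ => ?_
    have h1 : q.2 = g ω q.1 := h1
    have h2 : q.2 = g ω' q.1 := h2
    rcases lt_or_gt_of_ne hne with h | h
    · linarith [hlt_g ω hω ω' hω' h q.1]
    · linarith [hlt_g ω' hω' ω hω h q.1]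
  · refine ⟨_, (horb ω hω).isAubryMather hδ (fun p hp => (hdisp p hp).1) (hrot ω hω), ?_⟩
    rintro _ ⟨n, rfl⟩
    have h1 := le_lowerEnv hK' (hAnnA ω hω) (hXA ω hω n) (X ω n)
    have h2 := upperEnv_le hK' (hAnnB ω hω) (hXB ω hω n) (X ω n)
    have h3 := hLU ω hω (X ω n)
    simp only [sub_self, abs_zero, mul_zero, sub_zero, add_zero] at h1 h2
    have e1 : L ω (X ω n) = Y ω n := le_antisymm (h3.trans h2) h1
    have e2 : U ω (X ω n) = Y ω n := le_antisymm h2 (h1.trans h3)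
    change Y ω n = (1 - θ ω) * L ω (X ω n) + θ ω * U ω (X ω n)
    rw [e1, e2]; ring
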